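/- arXiv:0709.2334 — 2 statements merged into one kernel-verified Lean document; each statement's English description precedes it below -/
import Mathlib

section
/- (Brown–Zhang) Let k be a field and let H be a noetherian AS-Gorenstein Hopf algebra over k. Let π : H → k be the algebra epimorphism with kernel the right annihilator of the left integral ∫^l_H, and let τ^l_π and τ^r_π be the associated left and right winding automorphisms. Then there exists an inner automorphism γ of H such that S⁴ = γ ∘ τ^r_π ∘ (τ^l_π)^{-1}, where S is the antipode. -/
open CategoryTheory

universe w v u u' u2

/-!
STATEMENT 16 (Brown–Zhang):
Let `H` be a noetherian AS-Gorenstein Hopf algebra over a field `k`, with injective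
dimension `d`, and let `π : H → k` be the algebra epimorphism whose kernel is the
right annihilator of the left integral `∫^l_H = Ext^d_H (k, H)` (a one-dimensional
`H`-bimodule).  Then there is an inner automorphism `γ` of `H` with
`S⁴ = γ ∘ τ^r_π ∘ (τ^l_π)⁻¹`; equivalently, `S⁴ ∘ τ^l_π = γ ∘ τ^r_π`, which is the
form stated below.
-/

/-! ### Ext groups over an arbitrary ring -/

instance hasExtModuleCat (R : Type u) [Ring R] :
    HasExt.{max u (v + 1)} (ModuleCat.{v} R) :=
  letI := HasDerivedCategory.standard (ModuleCat.{v} R)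
  hasExt_of_hasDerivedCategory _

/-- The canonical map `(X ⟶ Y) → Ext X Y 0` is additive. -/
lemma Ext_mk₀_add {C : Type*} [Category C] [Abelian C] [HasExt.{w} C] {X Y : C}
    (f g : X ⟶ Y) :
    Abelian.Ext.mk₀ (f + g) = Abelian.Ext.mk₀ f + Abelian.Ext.mk₀ g := by
  letI := HasDerivedCategory.standard C
  ext
  rw [Abelian.Ext.add_hom, Abelian.Ext.mk₀_hom, Abelian.Ext.mk₀_hom, Abelian.Ext.mk₀_hom,
    Functor.map_add]
  dsimp [ShiftedHom.mk₀]
  rw [Preadditive.add_comp]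

/-- The Ext-group `Ext_A^i (M, N)` for two left `A`-modules `M` and `N`. -/
noncomputable abbrev ExtGroup (A : Type u) [Ring A]
    (M : Type v) [AddCommGroup M] [Module A M]
    (N : Type w) [AddCommGroup N] [Module A N] (i : ℕ) :=
  Abelian.Ext (C := ModuleCat.{max v w u} A)
    (ModuleCat.of A (ULift.{max w u} M)) (ModuleCat.of A (ULift.{max v u} N)) i

/-! ### The right `A`-module structure on `Ext_A^i (M, A)` -/

/-- Right multiplication by `a : A` on `A`, as an endomorphism of the left module `A`. -/
def rmulLinear (A : Type u) [Ring A] (a : A) :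
    ULift.{w} A →ₗ[A] ULift.{w} A where
  toFun x := ⟨x.down * a⟩
  map_add' x y := by ext; exact add_mul _ _ _
  map_smul' r x := by ext; exact mul_assoc r x.down a

/-- The right action of `A` on `Ext_A^i (M, A)` induced by right multiplication of `A`
on itself (which is an endomorphism of `A` as a left `A`-module). -/
noncomputable def extSmulOp (A : Type u) [Ring A]
    (M : Type v) [AddCommGroup M] [Module A M] (i : ℕ)
    (a : Aᵐᵒᵖ) (e : ExtGroup A M A i) : ExtGroup A M A i :=
  e.comp (Abelian.Ext.mk₀ (ModuleCat.ofHom (rmulLinear A a.unop))) (add_zero i)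

/-- `Ext_A^i (M, A)` is a right `A`-module, i.e. a module over `Aᵐᵒᵖ`, via the right
multiplication action of `A` on itself. -/
noncomputable instance extGroupModuleOp (A : Type u) [Ring A]
    (M : Type v) [AddCommGroup M] [Module A M] (i : ℕ) :
    Module Aᵐᵒᵖ (ExtGroup A M A i) where
  smul a e := extSmulOp A M i a e
  one_smul e := by
    show extSmulOp A M i 1 e = e
    unfold extSmulOp
    have h1 : ModuleCat.ofHom (rmulLinear A ((1 : Aᵐᵒᵖ).unop)) =
        𝟙 (ModuleCat.of A (ULift.{max v u} A)) := by
      ext x : 2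
      exact ULift.ext _ _ (mul_one x.down)
    rw [h1, Abelian.Ext.comp_mk₀_id]
  mul_smul a b e := by
    show extSmulOp A M i (a * b) e = extSmulOp A M i a (extSmulOp A M i b e)
    unfold extSmulOp
    have h1 : ModuleCat.ofHom (rmulLinear A ((a * b).unop)) =
        ModuleCat.ofHom (rmulLinear A b.unop) ≫ ModuleCat.ofHom (rmulLinear A a.unop) := by
      ext x : 2
      exact ULift.ext _ _ (mul_assoc x.down b.unop a.unop).symm
    rw [h1, ← Abelian.Ext.mk₀_comp_mk₀,
      ← Abelian.Ext.comp_assoc_of_second_deg_zero]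
  smul_zero a := by
    show extSmulOp A M i a 0 = 0
    unfold extSmulOp
    exact Abelian.Ext.zero_comp _ i
      (Abelian.Ext.mk₀ (ModuleCat.ofHom (rmulLinear A a.unop))) i (add_zero i)
  smul_add a e f := by
    show extSmulOp A M i a (e + f) = extSmulOp A M i a e + extSmulOp A M i a f
    unfold extSmulOp
    exact Abelian.Ext.add_comp _ _ _ _
  add_smul a b e := by
    show extSmulOp A M i (a + b) e = extSmulOp A M i a e + extSmulOp A M i b e
    unfold extSmulOp
    have h1 : ModuleCat.ofHom (rmulLinear A ((a + b).unop)) =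
        ModuleCat.ofHom (rmulLinear A a.unop) + ModuleCat.ofHom (rmulLinear A b.unop) := by
      ext x : 2
      exact ULift.ext _ _ (mul_add x.down a.unop b.unop)
    rw [h1, Ext_mk₀_add, Abelian.Ext.comp_add]
  zero_smul e := by
    show extSmulOp A M i 0 e = 0
    unfold extSmulOp
    have h1 : ModuleCat.ofHom (rmulLinear A ((0 : Aᵐᵒᵖ).unop)) =
        (0 : ModuleCat.of A (ULift.{max v u} A) ⟶ ModuleCat.of A (ULift.{max v u} A)) := by
      ext x : 2
      exact ULift.ext _ _ (mul_zero x.down)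
    rw [h1, Abelian.Ext.mk₀_zero, Abelian.Ext.comp_zero]

/-! ### Grade and injective dimension -/

/-- The grade `j(M) = inf { j | Ext_A^j (M, A) ≠ 0 }` of an `A`-module `M`,
an element of `ℕ∞` (with `inf ∅ = ∞`). -/
noncomputable def moduleGrade (A : Type u) [Ring A]
    (M : Type v) [AddCommGroup M] [Module A M] : ℕ∞ :=
  sInf {j : ℕ∞ | ∃ i : ℕ, j = (i : ℕ∞) ∧ Nontrivial (ExtGroup A M A i)}

/-- The injective dimension of `A` as a left module over itself, an element of `ℕ∞`:
the least `n` such that `Ext_A^i (M, A) = 0` for all modules `M` and all `i > n`. -/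
noncomputable def selfInjectiveDimension (A : Type u) [Ring A] : ℕ∞ :=
  sInf {d : ℕ∞ | ∃ n : ℕ, d = (n : ℕ∞) ∧
    ∀ (M : Type u) [AddCommGroup M] [Module A M],
      ∀ i : ℕ, n < i → Subsingleton (ExtGroup A M A i)}

/-- A ring has finite global dimension if there is a uniform bound above which all
Ext-groups vanish. -/
def HasFiniteGlobalDimension (A : Type u) [Ring A] : Prop :=
  ∃ n : ℕ, ∀ (M N : Type u) [AddCommGroup M] [Module A M] [AddCommGroup N] [Module A N],
    ∀ i : ℕ, n < i → Subsingleton (ExtGroup A M N i)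

/-- The Auslander condition: for every noetherian left `A`-module `M`, every `i ≥ 0` and
every (right-) submodule `N` of `Ext_A^i (M, A)`, one has `j(N) ≥ i`. -/
def AuslanderCondition (A : Type u) [Ring A] : Prop :=
  ∀ (M : Type u) [AddCommGroup M] [Module A M], IsNoetherian A M →
    ∀ (i : ℕ) (N : Submodule Aᵐᵒᵖ (ExtGroup A M A i)), (i : ℕ∞) ≤ moduleGrade Aᵐᵒᵖ ↥N

/-! ### The `k`-module structure on `Ext_A^i (M, N)` for a `k`-algebra `A` -/

/-- Scalar multiplication by `c : k` on an `A`-module `N`, as an `A`-linear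
endomorphism, where `A` is a `k`-algebra. -/
def scalarLinear (k : Type u') (A : Type u) [CommRing k] [Ring A] [Algebra k A]
    (N : Type v) [AddCommGroup N] [Module A N] (c : k) :
    ULift.{u2} N →ₗ[A] ULift.{u2} N where
  toFun x := ⟨algebraMap k A c • x.down⟩
  map_add' x y := by ext; exact smul_add _ _ _
  map_smul' a x := by
    ext
    show algebraMap k A c • a • x.down = a • algebraMap k A c • x.down
    rw [smul_smul, smul_smul, Algebra.commutes]

/-- The action of `k` on `Ext_A^i (M, N)`, for a `k`-algebra `A`. -/
noncomputable def extSmulBase {k : Type u'} (A : Type u) [CommRing k] [Ring A] [Algebra k A]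
    (M : Type v) [AddCommGroup M] [Module A M]
    (N : Type w) [AddCommGroup N] [Module A N] (i : ℕ)
    (c : k) (e : ExtGroup A M N i) : ExtGroup A M N i :=
  e.comp (Abelian.Ext.mk₀ (ModuleCat.ofHom (scalarLinear k A N c))) (add_zero i)

/-- `Ext_A^i (M, N)` is a `k`-module when `A` is a `k`-algebra. -/
noncomputable instance extGroupModuleBase (k : Type u') (A : Type u)
    [CommRing k] [Ring A] [Algebra k A]
    (M : Type v) [AddCommGroup M] [Module A M]
    (N : Type w) [AddCommGroup N] [Module A N] (i : ℕ) :
    Module k (ExtGroup A M N i) where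
  smul c e := extSmulBase A M N i c e
  one_smul e := by
    show extSmulBase A M N i 1 e = e
    unfold extSmulBase
    have h1 : ModuleCat.ofHom (scalarLinear k A N (1 : k)) =
        𝟙 (ModuleCat.of A (ULift.{max v u} N)) := by
      ext x : 2
      exact ULift.ext _ _
        (show algebraMap k A (1 : k) • x.down = x.down by rw [map_one, one_smul])
    rw [h1, Abelian.Ext.comp_mk₀_id]
  mul_smul c d e := by
    show extSmulBase A M N i (c * d) e = extSmulBase A M N i c (extSmulBase A M N i d e)
    unfold extSmulBase
    have h1 : ModuleCat.ofHom (scalarLinear k A N (c * d)) =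
        ModuleCat.ofHom (scalarLinear k A N d) ≫ ModuleCat.ofHom (scalarLinear k A N c) := by
      ext x : 2
      exact ULift.ext _ _
        (show algebraMap k A (c * d) • x.down = algebraMap k A c • algebraMap k A d • x.down
          by rw [map_mul, mul_smul])
    rw [h1, ← Abelian.Ext.mk₀_comp_mk₀,
      ← Abelian.Ext.comp_assoc_of_second_deg_zero]
  smul_zero c := by
    show extSmulBase A M N i c 0 = 0
    unfold extSmulBase
    exact Abelian.Ext.zero_comp _ i
      (Abelian.Ext.mk₀ (ModuleCat.ofHom (scalarLinear k A N c))) i (add_zero i)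
  smul_add c e f := by
    show extSmulBase A M N i c (e + f) = extSmulBase A M N i c e + extSmulBase A M N i c f
    unfold extSmulBase
    exact Abelian.Ext.add_comp _ _ _ _
  add_smul c d e := by
    show extSmulBase A M N i (c + d) e = extSmulBase A M N i c e + extSmulBase A M N i d e
    unfold extSmulBase
    have h1 : ModuleCat.ofHom (scalarLinear k A N (c + d)) =
        ModuleCat.ofHom (scalarLinear k A N c) + ModuleCat.ofHom (scalarLinear k A N d) := by
      ext x : 2
      exact ULift.ext _ _
        (show algebraMap k A (c + d) • x.down =
            algebraMap k A c • x.down + algebraMap k A d • x.down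
          by rw [map_add, add_smul])
    rw [h1, Ext_mk₀_add, Abelian.Ext.comp_add]
  zero_smul e := by
    show extSmulBase A M N i (0 : k) e = 0
    unfold extSmulBase
    have h1 : ModuleCat.ofHom (scalarLinear k A N (0 : k)) =
        (0 : ModuleCat.of A (ULift.{max v u} N) ⟶ ModuleCat.of A (ULift.{max v u} N)) := by
      ext x : 2
      exact ULift.ext _ _
        (show algebraMap k A (0 : k) • x.down = 0 by rw [map_zero, zero_smul])
    rw [h1, Abelian.Ext.mk₀_zero, Abelian.Ext.comp_zero]

/-! ### The trivial module of a Hopf algebra -/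

/-- The trivial left `H`-module `k`: the field `k`, with `H` acting through the
counit `ε : H → k`. -/
@[nolint unusedArguments]
def TrivialCounitModule (k : Type u') (H : Type u) [CommSemiring k] [Semiring H]
    [HopfAlgebra k H] : Type u' := k

instance (k : Type u') (H : Type u) [Field k] [Ring H] [HopfAlgebra k H] :
    AddCommGroup (TrivialCounitModule k H) :=
  inferInstanceAs (AddCommGroup k)

noncomputable instance (k : Type u') (H : Type u) [Field k] [Ring H] [HopfAlgebra k H] :
    Module H (TrivialCounitModule k H) :=
  Module.compHom k (Bialgebra.counitAlgHom k H).toRingHom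

/-! ### Winding automorphisms -/

open TensorProduct in
/-- The left winding endomorphism `τ^l_π : h ↦ Σ π(h₁) h₂` attached to an algebra
homomorphism `π : H → k`. -/
noncomputable def leftWinding {k : Type u'} {H : Type u} [CommSemiring k] [Semiring H]
    [Bialgebra k H] (π : H →ₐ[k] k) : H →ₗ[k] H :=
  (TensorProduct.lid k H).toLinearMap ∘ₗ
    (TensorProduct.map π.toLinearMap LinearMap.id) ∘ₗ Coalgebra.comul

open TensorProduct in
/-- The right winding endomorphism `τ^r_π : h ↦ Σ h₁ π(h₂)` attached to an algebra
homomorphism `π : H → k`. -/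
noncomputable def rightWinding {k : Type u'} {H : Type u} [CommSemiring k] [Semiring H]
    [Bialgebra k H] (π : H →ₐ[k] k) : H →ₗ[k] H :=
  (TensorProduct.rid k H).toLinearMap ∘ₗ
    (TensorProduct.map LinearMap.id π.toLinearMap) ∘ₗ Coalgebra.comul

section GeneralExt

open Abelian

/-- Over a left noetherian ring, every class in `Ext^n (M, N)` with `M` finitely generated is
fixed by an endomorphism `p s` of `N`, as soon as the `p s` are eventually the identity on each
element of `N`. -/
theorem exists_comp_eq_of_locally_id {R : Type u} [Ring R] [IsNoetherianRing R]
    [HasExt.{w} (ModuleCat.{u} R)] {N : ModuleCat.{u} R} {ι : Type v} (p : Finset ι → (N ⟶ N))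
    (hmono : ∀ s t x, s ⊆ t → (p s).hom x = x → (p t).hom x = x)
    (hp : ∀ x : N, ∃ s, (p s).hom x = x) (n : ℕ) (M : ModuleCat.{u} R) [Module.Finite R M]
    (e : Ext M N n) : ∃ s, e.comp (Ext.mk₀ (p s)) (add_zero n) = e := by
  classical
  induction n generalizing M with
  | zero =>
    obtain ⟨f, rfl⟩ := (Ext.mk₀_bijective M N).2 e
    obtain ⟨S, hS⟩ := Module.Finite.fg_top (R := R) (M := M)
    choose t ht using hp
    refine ⟨S.biUnion fun m => t (f.hom m), ?_⟩
    rw [Ext.mk₀_comp_mk₀]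
    congr 1
    ext1
    refine LinearMap.ext_on hS fun m hm => ?_
    exact hmono _ _ _ (Finset.subset_biUnion_of_mem (fun m => t (f.hom m)) hm) (ht _)
  | succ n ih =>
    obtain ⟨m, f, hf⟩ := Module.Finite.exists_fin' R M
    let g : ModuleCat.of R (ULift.{u} (Fin m → R)) ⟶ M :=
      ModuleCat.ofHom (f ∘ₗ ULift.moduleEquiv.toLinearMap)
    have hg : Function.Surjective g.hom := hf.comp ULift.moduleEquiv.surjective
    have hS := LinearMap.shortExact_shortComplexKer (f := g.hom) hg
    have : Module.Finite R (ULift.{u} (Fin m → R)) :=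
      Module.Finite.equiv (ULift.moduleEquiv (R := R)).symm
    have : Module.Finite R (g.hom.shortComplexKer).X₁ := by
      show Module.Finite R (LinearMap.ker g.hom)
      have : IsNoetherian R (ULift.{u} (Fin m → R)) := isNoetherian_of_isNoetherianRing_of_finite R _
      infer_instance
    have : Module.Free R (ULift.{u} (Fin m → R)) :=
      Module.Free.of_equiv (ULift.moduleEquiv (R := R)).symm
    have : Projective (g.hom.shortComplexKer).X₂ :=
      (IsProjective.iff_projective (R := R) (ULift.{u} (Fin m → R))).1 inferInstance
    obtain ⟨e', rfl⟩ := Ext.contravariant_sequence_exact₃ hS N e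
      (Ext.eq_zero_of_projective _) (add_comm 1 n)
    obtain ⟨s, hs⟩ := ih _ e'
    refine ⟨s, ?_⟩
    rw [Ext.comp_assoc_of_third_deg_zero, hs]

end GeneralExt

section ExactRightAdjoint

open Abelian

variable {C D : Type*} [Category* C] [Category* D] [Abelian C] [Abelian D]
  [HasExt.{w} C] [HasExt.{v} D] (G : C ⥤ D) [G.Additive]
  [Limits.PreservesFiniteLimits G] [Limits.PreservesFiniteColimits G]

/-- An exact functor `G` preserving injectives and an element `u : X ⟶ G Y` representing
`Hom (X, G -)` induce isomorphisms `Ext (Y, N) ≃ Ext (X, G N)`. -/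
theorem bijective_comp_mapExactFunctor [EnoughInjectives C] [G.PreservesInjectiveObjects]
    {X : D} {Y : C} (a : X ⟶ G.obj Y)
    (ha : ∀ N : C, Function.Bijective fun f : Y ⟶ N => a ≫ G.map f) (n : ℕ) (N : C) :
    Function.Bijective fun e : Ext Y N n =>
      (Ext.mk₀ a).comp (e.mapExactFunctor G) (zero_add n) := by
  induction n generalizing N with
  | zero =>
    have h : (fun e : Ext Y N 0 => (Ext.mk₀ a).comp (e.mapExactFunctor G) (zero_add 0)) =
        Ext.homEquiv₀.symm ∘ (fun f : Y ⟶ N => a ≫ G.map f) ∘ Ext.homEquiv₀ := by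
      ext1 e
      obtain ⟨f, rfl⟩ := (Ext.mk₀_bijective Y N).2 e
      simp [Ext.mapExactFunctor_mk₀, Ext.homEquiv₀]
    rw [h]
    exact Ext.homEquiv₀.symm.bijective.comp ((ha N).comp Ext.homEquiv₀.bijective)
  | succ n ih =>
    let I : InjectivePresentation N := Classical.arbitrary _
    let S := ShortComplex.mk _ _ (Limits.cokernel.condition I.f)
    have hS : S.ShortExact := { exact := ShortComplex.exact_cokernel I.f }
    have : Injective S.X₂ := I.injective
    have : Injective (S.map G).X₂ :=
      Functor.PreservesInjectiveObjects.injective_obj I.injective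
    have hcls := Ext.mapExactFunctor_extClass G hS
    constructor
    · have key : ∀ e : Ext Y N (n + 1),
          (Ext.mk₀ a).comp (e.mapExactFunctor G) (zero_add (n + 1)) = 0 → e = 0 := by
        intro e he
        obtain ⟨e', rfl⟩ := Ext.covariant_sequence_exact₁ Y hS e (Ext.eq_zero_of_injective _) rfl
        rw [Ext.mapExactFunctor_comp, ← Ext.comp_assoc _ _ _ (zero_add n) rfl (by lia),
          hcls] at he
        obtain ⟨y, hy⟩ := Ext.covariant_sequence_exact₃ X (hS.map_of_exact G) _ rfl he
        obtain ⟨y', rfl⟩ := (ih _).2 y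
        have : e' = y'.comp (Ext.mk₀ S.g) (add_zero n) := by
          apply (ih _).1
          dsimp only
          rw [Ext.mapExactFunctor_comp, Ext.mapExactFunctor_mk₀, ← hy]
          exact Ext.comp_assoc _ _ _ (zero_add n) (add_zero n) (by lia)
        rw [this, Ext.comp_assoc _ _ _ (add_zero n) (zero_add 1) (by lia), hS.comp_extClass,
          Ext.comp_zero]
      exact (injective_iff_map_eq_zero (((Ext.mk₀ a).precomp _ (zero_add (n + 1))).comp
        (G.mapExtAddHom Y N (n + 1)))).2 key
    · intro e
      obtain ⟨e', rfl⟩ := Ext.covariant_sequence_exact₁ X (hS.map_of_exact G) e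
        (Ext.eq_zero_of_injective _) rfl
      obtain ⟨e'', rfl⟩ := (ih _).2 e'
      refine ⟨e''.comp hS.extClass rfl, ?_⟩
      dsimp only
      rw [Ext.mapExactFunctor_comp, ← Ext.comp_assoc _ _ _ (zero_add n) rfl (by lia), hcls]
      rfl

end ExactRightAdjoint

section Enveloping

open TensorProduct MulOpposite Coalgebra WithConv

theorem sum_mul_eq_of_convolution_inverse {k C B : Type*} [CommSemiring k] [AddCommMonoid C]
    [Module k C] [Coalgebra k C] [Semiring B] [Algebra k B] {f g h d : C →ₗ[k] B}
    (hgh : ∀ x (r : Repr k x (C × C)),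
      ∑ i ∈ r.index, g (r.left i) * h (r.right i) = algebraMap k B (counit x))
    (hd : ∀ x (r : Repr k x (C × C)), d x = ∑ i ∈ r.index, f (r.left i) * g (r.right i))
    {a : C} {ι : Type*} (r : Repr k a ι) :
    ∑ i ∈ r.index, d (r.left i) * h (r.right i) = f a := by
  have h1 : toConv g * toConv h = 1 := by
    apply WithConv.ext
    ext x
    exact ((Repr.arbitrary k x).convMul_apply _ _).trans (hgh x _)
  have h2 : toConv d = toConv f * toConv g := by
    apply WithConv.ext
    ext x
    exact (hd x (Repr.arbitrary k x)).trans ((Repr.arbitrary k x).convMul_apply _ _).symm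
  have h3 : toConv d * toConv h = toConv f := by rw [h2, mul_assoc, h1, mul_one]
  exact (r.convMul_apply _ _).symm.trans (congrArg (fun f : WithConv (C →ₗ[k] B) => f.ofConv a) h3)

/-- The enveloping algebra `H ⊗ Hᵐᵒᵖ`, whose left modules are the `H`-bimodules. -/
abbrev EnvelopingAlgebra (k : Type u') [Field k] (H : Type u) [Ring H] [Algebra k H] : Type u :=
  H ⊗[k] Hᵐᵒᵖ

variable (k : Type u') [Field k] (H : Type u) [Ring H] [HopfAlgebra k H]

/-- The algebra map `h ↦ h₁ ⊗ S(h₂)` from `H` to its enveloping algebra. -/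
noncomputable def envelopingEmbedding : H →ₐ[k] EnvelopingAlgebra k H :=
  (Algebra.TensorProduct.map (AlgHom.id k H) (HopfAlgebra.antipodeAlgHomOp k H)).comp
    (Bialgebra.comulAlgHom k H)

/-- The linear map `h ↦ h₁ ⊗ S²(h₂)`. -/
noncomputable def envelopingTwist : H →ₗ[k] EnvelopingAlgebra k H :=
  TensorProduct.map LinearMap.id ((opLinearEquiv k).toLinearMap ∘ₗ
    HopfAlgebra.antipode k ∘ₗ HopfAlgebra.antipode k) ∘ₗ comul

variable {k H}

theorem envelopingEmbedding_eq_sum {a : H} {ι : Type*} (r : Repr k a ι) :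
    envelopingEmbedding k H a =
      ∑ i ∈ r.index, r.left i ⊗ₜ[k] op (HopfAlgebra.antipode k (r.right i)) := by
  simp only [envelopingEmbedding, AlgHom.comp_apply, Bialgebra.comulAlgHom_apply, ← r.eq, map_sum]
  rfl

theorem envelopingTwist_eq_sum {a : H} {ι : Type*} (r : Repr k a ι) :
    envelopingTwist k H a = ∑ i ∈ r.index, r.left i ⊗ₜ[k]
      op (HopfAlgebra.antipode k (HopfAlgebra.antipode k (r.right i))) := by
  simp only [envelopingTwist, LinearMap.comp_apply, ← r.eq, map_sum]
  rfl

variable (k H) in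
/-- `x ↦ 1 ⊗ S(x)`. -/
noncomputable def rightAntipode : H →ₗ[k] EnvelopingAlgebra k H :=
  TensorProduct.mk k H Hᵐᵒᵖ 1 ∘ₗ (opLinearEquiv k).toLinearMap ∘ₗ HopfAlgebra.antipode k

variable (k H) in
/-- `x ↦ 1 ⊗ S²(x)`. -/
noncomputable def rightAntipodeSq : H →ₗ[k] EnvelopingAlgebra k H :=
  rightAntipode k H ∘ₗ HopfAlgebra.antipode k

@[simp] theorem rightAntipode_apply (x : H) :
    rightAntipode k H x = 1 ⊗ₜ op (HopfAlgebra.antipode k x) := rfl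

@[simp] theorem rightAntipodeSq_apply (x : H) : rightAntipodeSq k H x =
    1 ⊗ₜ op (HopfAlgebra.antipode k (HopfAlgebra.antipode k x)) := rfl

theorem sum_rightAntipode_mul {x : H} {ι : Type*} (r : Repr k x ι) :
    ∑ i ∈ r.index, rightAntipode k H (r.left i) * rightAntipodeSq k H (r.right i) =
      algebraMap k (EnvelopingAlgebra k H) (counit x) := by
  have h := congrArg (fun z : H => (1 : H) ⊗ₜ[k] op (HopfAlgebra.antipode k z))
    (HopfAlgebra.sum_mul_antipode_eq_algebraMap_counit r)
  simp only [map_sum, HopfAlgebra.antipode_mul_antidistrib, Finset.op_sum, tmul_sum] at h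
  simp only [rightAntipode_apply, rightAntipodeSq_apply,
    Algebra.TensorProduct.tmul_mul_tmul, one_mul, ← op_mul]
  refine h.trans ?_
  simp [Algebra.algebraMap_eq_smul_one, HopfAlgebra.antipode_one, Algebra.TensorProduct.one_def]

theorem sum_rightAntipodeSq_mul {x : H} {ι : Type*} (r : Repr k x ι) :
    ∑ i ∈ r.index, rightAntipodeSq k H (r.left i) * rightAntipode k H (r.right i) =
      algebraMap k (EnvelopingAlgebra k H) (counit x) := by
  have h := congrArg (fun z : H => (1 : H) ⊗ₜ[k] op (HopfAlgebra.antipode k z))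
    (HopfAlgebra.sum_antipode_mul_eq_algebraMap_counit r)
  simp only [map_sum, HopfAlgebra.antipode_mul_antidistrib, Finset.op_sum, tmul_sum] at h
  simp only [rightAntipode_apply, rightAntipodeSq_apply,
    Algebra.TensorProduct.tmul_mul_tmul, one_mul, ← op_mul]
  refine h.trans ?_
  simp [Algebra.algebraMap_eq_smul_one, HopfAlgebra.antipode_one, Algebra.TensorProduct.one_def]

theorem sum_envelopingEmbedding_mul {a : H} {ι : Type*} (r : Repr k a ι) :
    ∑ i ∈ r.index, envelopingEmbedding k H (r.left i) *
      (1 ⊗ₜ op (HopfAlgebra.antipode k (HopfAlgebra.antipode k (r.right i)))) = a ⊗ₜ[k] 1 :=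
  sum_mul_eq_of_convolution_inverse (f := (TensorProduct.mk k H Hᵐᵒᵖ).flip 1)
    (g := rightAntipode k H) (h := rightAntipodeSq k H)
    (d := (envelopingEmbedding k H).toLinearMap) (fun _ r => sum_rightAntipode_mul r)
    (fun _ r => (envelopingEmbedding_eq_sum r).trans (by simp)) r

theorem sum_envelopingTwist_mul {a : H} {ι : Type*} (r : Repr k a ι) :
    ∑ i ∈ r.index, envelopingTwist k H (r.left i) *
      (1 ⊗ₜ op (HopfAlgebra.antipode k (r.right i))) = a ⊗ₜ[k] 1 :=
  sum_mul_eq_of_convolution_inverse (f := (TensorProduct.mk k H Hᵐᵒᵖ).flip 1)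
    (g := rightAntipodeSq k H) (h := rightAntipode k H)
    (d := envelopingTwist k H) (fun _ r => sum_rightAntipodeSq_mul r)
    (fun _ r => (envelopingTwist_eq_sum r).trans (by simp)) r

theorem sum_op_mul_envelopingEmbedding {a : H} {ι : Type*} (r : Repr k a ι) :
    ∑ i ∈ r.index, (1 ⊗ₜ op (r.right i)) * envelopingEmbedding k H (r.left i) = a ⊗ₜ[k] 1 := by
  let F : H ⊗[k] (H ⊗[k] H) →ₗ[k] EnvelopingAlgebra k H :=
    TensorProduct.map LinearMap.id ((opLinearEquiv k).toLinearMap ∘ₗ LinearMap.mul' k H ∘ₗ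
      TensorProduct.map (HopfAlgebra.antipode k) LinearMap.id)
  have key : ∀ x y : H, (1 ⊗ₜ op y) * envelopingEmbedding k H x =
      F (TensorProduct.assoc k H H H (comul x ⊗ₜ y)) := by
    intro x y
    have s := Repr.arbitrary k x
    rw [envelopingEmbedding_eq_sum s, ← s.eq]
    simp [sum_tmul, Finset.mul_sum, F]
  have h := congrArg F (coassoc_apply (R := k) a)
  have s := Repr.arbitrary k a
  have h1 : F (TensorProduct.assoc k H H H (comul.rTensor H (comul (R := k) a))) =
      ∑ i ∈ r.index, (1 ⊗ₜ op (r.right i)) * envelopingEmbedding k H (r.left i) := by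
    simp only [key]
    rw [← r.eq]
    simp
  rw [← h1, h]
  have h2 : F ∘ₗ comul.lTensor H = LinearMap.lTensor H ((opLinearEquiv k).toLinearMap ∘ₗ
      Algebra.linearMap k H ∘ₗ counit) := by
    rw [← HopfAlgebra.mul_antipode_rTensor_comul]
    ext x y
    simp [F, LinearMap.rTensor]
  have h3 := congrArg (fun f => f (comul (R := k) a)) h2
  refine h3.trans ?_
  rw [← LinearMap.comp_assoc, LinearMap.lTensor_comp]
  simp

theorem sum_comul_mul {a : H} {ι : Type*} (r : Repr k a ι) :
    ∑ i ∈ r.index, comul (R := k) (r.left i) * (1 ⊗ₜ HopfAlgebra.antipode k (r.right i)) =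
      a ⊗ₜ[k] 1 := by
  refine sum_mul_eq_of_convolution_inverse (f := (TensorProduct.mk k H H).flip 1)
    (g := TensorProduct.mk k H H 1) (h := TensorProduct.mk k H H 1 ∘ₗ HopfAlgebra.antipode k)
    (d := comul) (fun x s => ?_) (fun x s => s.eq.symm.trans (by simp)) r
  simp only [LinearMap.comp_apply, mk_apply, Algebra.TensorProduct.tmul_mul_tmul, one_mul,
    ← tmul_sum, HopfAlgebra.sum_mul_antipode_eq_algebraMap_counit]
  simp [Algebra.algebraMap_eq_smul_one, Algebra.TensorProduct.one_def]

end Enveloping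

section InjectiveRestriction

open TensorProduct MulOpposite Coalgebra

variable {k : Type u'} [Field k] {H : Type u} [Ring H] [HopfAlgebra k H]

theorem sum_op_smul_envelopingEmbedding_smul {M : Type*} [AddCommGroup M]
    [Module (EnvelopingAlgebra k H) M] {x : H} {ι : Type*} (r : Repr k x ι) (y b : H) (m : M) :
    ∑ i ∈ r.index, ((1 : H) ⊗ₜ[k] op (r.right i * (b * y))) •
        (envelopingEmbedding k H (r.left i) • m) =
      (x ⊗ₜ[k] op y) • (((1 : H) ⊗ₜ[k] op b) • m) := by
  have h := sum_op_mul_envelopingEmbedding r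
  have h2 : (x ⊗ₜ[k] op y) * ((1 : H) ⊗ₜ[k] op b) = (1 : H) ⊗ₜ[k] op (b * y) * (x ⊗ₜ[k] 1) := by
    simp
  rw [smul_smul, h2, ← h, Finset.mul_sum, Finset.sum_smul]
  refine Finset.sum_congr rfl fun i _ => ?_
  have h3 : (1 : H) ⊗ₜ[k] op (r.right i * (b * y)) =
      ((1 : H) ⊗ₜ[k] op (b * y)) * ((1 : H) ⊗ₜ[k] op (r.right i)) := by
    simp [mul_assoc]
  rw [smul_smul, h3, mul_assoc]

variable (k H) in
/-- The linear map `a ⊗ b ↦ (1 ⊗ b) (a₁ ⊗ S(a₂))`. -/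
noncomputable def envelopingRightSpan : H ⊗[k] H →ₗ[k] EnvelopingAlgebra k H :=
  TensorProduct.lift (LinearMap.mk₂ k (fun a b => (1 ⊗ₜ op b) * envelopingEmbedding k H a)
    (fun a a' b => by rw [map_add, mul_add]) (fun c a b => by rw [map_smul, mul_smul_comm])
    (fun a b b' => by rw [MulOpposite.op_add, tmul_add, add_mul])
    (fun c a b => by rw [MulOpposite.op_smul, tmul_smul, smul_mul_assoc]))

@[simp] theorem envelopingRightSpan_tmul (a b : H) :
    envelopingRightSpan k H (a ⊗ₜ b) = (1 ⊗ₜ op b) * envelopingEmbedding k H a := rfl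

theorem envelopingRightSpan_injective : Function.Injective (envelopingRightSpan k H) := by
  let F : EnvelopingAlgebra k H →ₗ[k] H ⊗[k] H :=
    TensorProduct.lift (LinearMap.mk₂ k (fun a b => comul (R := k) a * (1 ⊗ₜ unop b))
      (fun a a' b => by rw [map_add, add_mul]) (fun c a b => by rw [map_smul, smul_mul_assoc])
      (fun a b b' => by rw [MulOpposite.unop_add, tmul_add, mul_add])
      (fun c a b => by rw [MulOpposite.unop_smul, tmul_smul, mul_smul_comm]))
  have h : F ∘ₗ envelopingRightSpan k H = LinearMap.id := by
    ext a b
    have r := Repr.arbitrary k a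
    have h1 := congrArg (· * ((1 : H) ⊗ₜ[k] b)) (sum_comul_mul r)
    simp only [Finset.sum_mul, mul_assoc, Algebra.TensorProduct.tmul_mul_tmul, one_mul,
      mul_one] at h1
    simp only [AlgebraTensorModule.curry_apply, LinearMap.restrictScalars_self, curry_apply,
      LinearMap.comp_apply, envelopingRightSpan_tmul, LinearMap.id_apply]
    rw [← h1, envelopingEmbedding_eq_sum r, Finset.mul_sum, map_sum]
    simp [F, ← op_mul]
  exact Function.LeftInverse.injective (g := F) fun x => LinearMap.congr_fun h x

/-- Restriction along `h ↦ h₁ ⊗ S(h₂)` preserves injective modules. -/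
theorem baer_of_envelopingEmbedding {I : Type*} [AddCommGroup I]
    [Module (EnvelopingAlgebra k H) I] [Module k I] [IsScalarTower k (EnvelopingAlgebra k H) I]
    [Module H I] (hsmul : ∀ (h : H) (x : I), h • x = envelopingEmbedding k H h • x)
    (hI : Module.Baer (EnvelopingAlgebra k H) I) : Module.Baer H I := by
  intro J g
  have hg : ∀ (c : k) (a : J), g (c • a) = c • g a := by
    intro c a
    have : c • a = algebraMap k H c • a := by ext; simp [Algebra.smul_def]
    rw [this, map_smul, hsmul, AlgHom.commutes, algebraMap_smul]
  let f : J ⊗[k] H →ₗ[k] I :=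
    TensorProduct.lift (LinearMap.mk₂ k
      (fun a b => ((1 ⊗ₜ op b : EnvelopingAlgebra k H) • g a))
      (fun a a' b => by rw [map_add, smul_add])
      (fun c a b => by
        rw [hg, ← algebraMap_smul (EnvelopingAlgebra k H) c (g a), smul_smul,
          ← Algebra.commutes, mul_smul, algebraMap_smul])
      (fun a b b' => by rw [MulOpposite.op_add, tmul_add, add_smul])
      (fun c a b => by rw [MulOpposite.op_smul, tmul_smul, smul_assoc]))
  let θ : J ⊗[k] H →ₗ[k] EnvelopingAlgebra k H :=
    envelopingRightSpan k H ∘ₗ (J.subtype.restrictScalars k).rTensor H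
  have hθ : Function.Injective θ := envelopingRightSpan_injective.comp
    (Module.Flat.rTensor_preserves_injective_linearMap _ Subtype.val_injective)
  have key : ∀ (s : EnvelopingAlgebra k H) (t : J ⊗[k] H),
      ∃ t', θ t' = s * θ t ∧ f t' = s • f t := by
    intro s t
    induction s using TensorProduct.induction_on with
    | zero => exact ⟨0, by simp, by
        rw [map_zero]; exact (zero_smul (EnvelopingAlgebra k H) (f t)).symm⟩
    | add s s' hs hs' =>
      obtain ⟨u, hu, hu'⟩ := hs
      obtain ⟨v, hv, hv'⟩ := hs'
      exact ⟨u + v, by rw [map_add, hu, hv, add_mul], by rw [map_add, hu', hv', add_smul]⟩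
    | tmul x y =>
      induction t using TensorProduct.induction_on with
      | zero => exact ⟨0, by simp, by simp⟩
      | add s s' hs hs' =>
        obtain ⟨u, hu, hu'⟩ := hs
        obtain ⟨v, hv, hv'⟩ := hs'
        exact ⟨u + v, by rw [map_add, hu, hv, map_add, mul_add],
          by rw [map_add, hu', hv', map_add, smul_add]⟩
      | tmul a b =>
        have r := Repr.arbitrary k x
        refine ⟨∑ i ∈ r.index, (r.left i • a) ⊗ₜ (r.right i * (b * y.unop)), ?_, ?_⟩
        · have h := sum_op_smul_envelopingEmbedding_smul r y.unop b
            (envelopingEmbedding k H (a : H))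
          simp only [smul_eq_mul, op_unop, ← map_mul] at h
          rw [map_sum]
          exact h
        · have h := sum_op_smul_envelopingEmbedding_smul r y.unop b (g a)
          simp only [← hsmul, ← map_smul, op_unop] at h
          rw [map_sum]
          exact h
  let K : Ideal (EnvelopingAlgebra k H) :=
    { carrier := Set.range θ
      add_mem' := by
        rintro _ _ ⟨u, rfl⟩ ⟨v, rfl⟩
        exact ⟨u + v, map_add _ _ _⟩
      zero_mem' := ⟨0, map_zero _⟩
      smul_mem' := by
        rintro s _ ⟨u, rfl⟩
        exact (key s u).imp fun _ h => h.1 }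
  choose lift hlift using fun z : K => (z.2 : (z : EnvelopingAlgebra k H) ∈ Set.range θ)
  have lift_eq : ∀ (z : K) (t), θ t = z → lift z = t := fun z t h =>
    hθ ((hlift z).trans h.symm)
  let F : K →ₗ[EnvelopingAlgebra k H] I :=
    { toFun := fun z => f (lift z)
      map_add' := fun z z' => by
        rw [lift_eq (z + z') (lift z + lift z') (by rw [map_add, hlift, hlift]; rfl), map_add]
      map_smul' := fun s z => by
        obtain ⟨t, ht, ht'⟩ := key s (lift z)
        rw [lift_eq (s • z) t (by rw [ht, hlift]; rfl), ht']
        rfl }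
  obtain ⟨F', hF'⟩ := hI K F
  refine ⟨LinearMap.toSpanSingleton H I (F' 1), fun x hx => ?_⟩
  have hx' : θ (⟨x, hx⟩ ⊗ₜ 1) = envelopingEmbedding k H x := by
    simp [θ, ← Algebra.TensorProduct.one_def]
  have h := hF' (envelopingEmbedding k H x) ⟨_, hx'⟩
  rw [LinearMap.toSpanSingleton_apply, hsmul, ← map_smul, smul_eq_mul, mul_one, h]
  change f (lift _) = _
  rw [lift_eq _ _ hx']
  simp [f, ← Algebra.TensorProduct.one_def]

end InjectiveRestriction

section EnvelopingFunctor

open TensorProduct MulOpposite Coalgebra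

theorem exact_map_restrictScalars {R : Type u} {S : Type u'} [Ring R] [Ring S] (f : R →+* S)
    (T : ShortComplex (ModuleCat.{v} S)) (h : T.Exact) :
    (T.map (ModuleCat.restrictScalars.{v} f)).Exact := by
  rw [ShortComplex.ShortExact.moduleCat_exact_iff_function_exact] at h ⊢
  exact h

variable (k : Type u') [Field k] (H : Type u) [Ring H]

section HopfAlgebra

variable [HopfAlgebra k H]

/-- Restriction of bimodules to modules along `h ↦ h₁ ⊗ S(h₂)`, i.e. the functor taking a
bimodule to its underlying space with the adjoint action. -/
noncomputable abbrev adjointFunctor :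
    ModuleCat.{u} (EnvelopingAlgebra k H) ⥤ ModuleCat.{u} H :=
  ModuleCat.restrictScalars (envelopingEmbedding k H).toRingHom

noncomputable instance : Limits.PreservesFiniteLimits (adjointFunctor k H) :=
  have h : Limits.PreservesFiniteLimits (adjointFunctor k H) ∧
      Limits.PreservesFiniteColimits (adjointFunctor k H) :=
    ((adjointFunctor k H).exact_tfae.out 1 3).mp (exact_map_restrictScalars _)
  h.1

noncomputable instance : Limits.PreservesFiniteColimits (adjointFunctor k H) :=
  have h : Limits.PreservesFiniteLimits (adjointFunctor k H) ∧
      Limits.PreservesFiniteColimits (adjointFunctor k H) :=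
    ((adjointFunctor k H).exact_tfae.out 1 3).mp (exact_map_restrictScalars _)
  h.2

instance : (adjointFunctor k H).PreservesInjectiveObjects where
  injective_obj {I} _ := by
    have hI : Module.Baer (EnvelopingAlgebra k H) I :=
      Module.Baer.of_injective (Module.injective_module_of_injective_object _ _)
    let _ : Module k I := Module.compHom I (algebraMap k (EnvelopingAlgebra k H))
    have : IsScalarTower k (EnvelopingAlgebra k H) I :=
      ⟨fun c x m => (congrArg (· • m) (Algebra.smul_def c x)).trans (mul_smul _ _ _)⟩
    let _ : Module H I := Module.compHom I (envelopingEmbedding k H).toRingHom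
    have h : Module.Baer H I :=
      baer_of_envelopingEmbedding (k := k) (fun _ _ => rfl) hI
    have : Module.Injective H ((adjointFunctor k H).obj I) := h.injective
    exact Module.injective_object_of_injective_module H ((adjointFunctor k H).obj I)

end HopfAlgebra

section Bimodule

variable [Algebra k H]

/-- The algebra `H` as a bimodule over itself. -/
noncomputable def selfBimodule : ModuleCat.{u} (EnvelopingAlgebra k H) :=
  letI : Module (EnvelopingAlgebra k H) H :=
    Module.compHom H (AlgHom.mulLeftRight k H).toRingHom
  ModuleCat.of (EnvelopingAlgebra k H) H

/-- The identity of `H`, as a map into the underlying space of the bimodule `H`. -/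
noncomputable def toSelfBimodule : H ≃+ selfBimodule k H := AddEquiv.refl H

variable {k H}

theorem tmul_smul_toSelfBimodule (x y z : H) :
    (x ⊗ₜ[k] op y : EnvelopingAlgebra k H) • toSelfBimodule k H z =
      toSelfBimodule k H (x * z * y) :=
  AlgHom.mulLeftRight_apply k H x (op y) z

end Bimodule

variable {k H} [HopfAlgebra k H]

theorem envelopingEmbedding_smul_toSelfBimodule_one (h : H) :
    envelopingEmbedding k H h • toSelfBimodule k H 1 =
      toSelfBimodule k H (algebraMap k H (counit h)) := by
  have r := Repr.arbitrary k h
  rw [envelopingEmbedding_eq_sum r, ← HopfAlgebra.sum_mul_antipode_eq_algebraMap_counit r,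
    Finset.sum_smul, map_sum]
  simp only [tmul_smul_toSelfBimodule, mul_one]

/-- The `H`-linear map from the trivial module to the bimodule `H` with its adjoint action,
sending `1` to `1`. -/
noncomputable def trivialToSelfBimodule {X : ModuleCat.{u} H} (κ : X ≃+ k)
    (hκ : ∀ (h : H) (x : X), κ (h • x) = counit h * κ x) :
    X ⟶ (adjointFunctor k H).obj (selfBimodule k H) :=
  ModuleCat.ofHom (Y := (adjointFunctor k H).obj (selfBimodule k H))
    { toFun := fun x => toSelfBimodule k H (algebraMap k H (κ x))
      map_add' := fun x y => by rw [map_add, map_add, map_add]; rfl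
      map_smul' := fun h x => by
        have h1 : toSelfBimodule k H (algebraMap k H (κ x)) =
            algebraMap k (EnvelopingAlgebra k H) (κ x) • toSelfBimodule k H 1 := by
          rw [Algebra.TensorProduct.algebraMap_apply]
          exact ((tmul_smul_toSelfBimodule _ 1 1).trans (by simp)).symm
        change _ = envelopingEmbedding k H h • toSelfBimodule k H (algebraMap k H (κ x))
        rw [h1, smul_smul, ← Algebra.commutes, mul_smul,
          envelopingEmbedding_smul_toSelfBimodule_one, hκ,
          Algebra.TensorProduct.algebraMap_apply]
        refine Eq.trans ?_ (tmul_smul_toSelfBimodule _ 1 _).symm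
        rw [mul_one, ← map_mul, mul_comm] }

theorem bijective_comp_trivialToSelfBimodule {X : ModuleCat.{u} H} (κ : X ≃+ k)
    (hκ : ∀ (h : H) (x : X), κ (h • x) = counit h * κ x)
    (N : ModuleCat.{u} (EnvelopingAlgebra k H)) :
    Function.Bijective fun f : selfBimodule k H ⟶ N =>
      trivialToSelfBimodule κ hκ ≫ (adjointFunctor k H).map f := by
  have hone : trivialToSelfBimodule κ hκ (κ.symm 1) = toSelfBimodule k H 1 :=
    congrArg (toSelfBimodule k H) (by simp)
  constructor
  · intro f g hfg
    have h1 : f (toSelfBimodule k H 1) = g (toSelfBimodule k H 1) := by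
      rw [← hone]
      exact ConcreteCategory.congr_hom hfg (κ.symm 1)
    ext x
    obtain ⟨x, rfl⟩ := (toSelfBimodule k H).surjective x
    have hx : toSelfBimodule k H x =
        (x ⊗ₜ[k] op 1 : EnvelopingAlgebra k H) • toSelfBimodule k H 1 := by
      rw [tmul_smul_toSelfBimodule, mul_one, mul_one]
    rw [hx, map_smul, map_smul, h1]
  · intro g
    let n : N := g (κ.symm 1)
    have hn : ∀ h : H, envelopingEmbedding k H h • n =
        algebraMap k (EnvelopingAlgebra k H) (counit h) • n := by
      intro h
      have e1 : ∀ h : H, envelopingEmbedding k H h • n = g (h • κ.symm 1) := fun h =>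
        (map_smul g.hom h (κ.symm 1)).symm
      rw [← AlgHom.commutes (envelopingEmbedding k H), e1, e1]
      congr 1
      apply κ.injective
      rw [hκ, hκ, Bialgebra.counit_algebraMap]
    have hn' : ∀ y : H, ((1 : H) ⊗ₜ[k] op y : EnvelopingAlgebra k H) • n =
        (y ⊗ₜ[k] op 1 : EnvelopingAlgebra k H) • n := by
      intro y
      have r := Repr.arbitrary k y
      have h := congrArg (· • n) (sum_op_mul_envelopingEmbedding r)
      simp only [Finset.sum_smul, mul_smul, hn] at h
      refine Eq.trans ?_ h
      conv_lhs => rw [← Coalgebra.sum_counit_smul r]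
      simp only [smul_smul, ← Finset.sum_smul, ← Algebra.commutes, ← Algebra.smul_def]
      congr 1
      simp [Finset.op_sum, tmul_sum]
    let f : H →+ N :=
      AddMonoidHom.mk' (fun x => (x ⊗ₜ[k] op 1 : EnvelopingAlgebra k H) • n)
        fun x y => by rw [add_tmul, add_smul]
    let F : selfBimodule k H →ₗ[EnvelopingAlgebra k H] N :=
      { toFun := fun x => f ((toSelfBimodule k H).symm x)
        map_add' := fun x y => by rw [map_add, map_add]
        map_smul' := fun z x => by
          obtain ⟨x, rfl⟩ := (toSelfBimodule k H).surjective x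
          induction z using TensorProduct.induction_on with
          | zero =>
            have h0 : (0 : EnvelopingAlgebra k H) • toSelfBimodule k H x = 0 :=
              zero_smul (EnvelopingAlgebra k H) (toSelfBimodule k H x : selfBimodule k H)
            rw [h0, map_zero, map_zero, RingHom.id_apply, AddEquiv.symm_apply_apply]
            exact (zero_smul (EnvelopingAlgebra k H) (f x)).symm
          | add z w hz hw =>
            simp only [add_smul, map_add, RingHom.id_apply] at hz hw ⊢
            rw [hz, hw]
          | tmul z w =>
            have e : z ⊗ₜ[k] w = z ⊗ₜ[k] op w.unop := rfl
            rw [e, tmul_smul_toSelfBimodule, AddEquiv.symm_apply_apply, RingHom.id_apply,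
              AddEquiv.symm_apply_apply]
            change (_ : EnvelopingAlgebra k H) • n = _ • ((_ : EnvelopingAlgebra k H) • n)
            have e1 : ((z * x * w.unop) ⊗ₜ[k] op 1 : EnvelopingAlgebra k H) =
                ((z * x) ⊗ₜ[k] op 1) * (w.unop ⊗ₜ[k] op 1) := by simp
            have e2 : (z ⊗ₜ[k] op w.unop : EnvelopingAlgebra k H) * (x ⊗ₜ[k] op 1) =
                ((z * x) ⊗ₜ[k] op 1) * (1 ⊗ₜ[k] op w.unop) := by simp
            rw [smul_smul, e1, e2, mul_smul, mul_smul, hn'] }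
    refine ⟨ModuleCat.ofHom (X := selfBimodule k H) (Y := N) F, ?_⟩
    ext x
    change f (algebraMap k H (κ x)) = g x
    have hx : x = algebraMap k H (κ x) • κ.symm 1 := by
      apply κ.injective
      rw [hκ, Bialgebra.counit_algebraMap, AddEquiv.apply_symm_apply, mul_one]
    conv_rhs => rw [hx]
    have e3 : g (algebraMap k H (κ x) • κ.symm 1) =
        envelopingEmbedding k H (algebraMap k H (κ x)) • n := map_smul g.hom _ _
    rw [e3, AlgHom.commutes, Algebra.TensorProduct.algebraMap_apply]
    rfl

end EnvelopingFunctor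

section Shear

open TensorProduct MulOpposite Coalgebra

variable (k : Type u') [Field k] (H : Type u) [Ring H] [HopfAlgebra k H]

/-- The linear map `a ⊗ v ↦ f(a) (1 ⊗ v)`. -/
noncomputable def shearOf (f : H →ₗ[k] EnvelopingAlgebra k H) :
    EnvelopingAlgebra k H →ₗ[k] EnvelopingAlgebra k H :=
  TensorProduct.lift ((LinearMap.mul k (EnvelopingAlgebra k H)).compl₁₂ f
    (TensorProduct.mk k H Hᵐᵒᵖ 1))

variable {k H}

@[simp] theorem shearOf_tmul (f : H →ₗ[k] EnvelopingAlgebra k H) (a : H) (v : Hᵐᵒᵖ) :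
    shearOf k H f (a ⊗ₜ v) = f a * (1 ⊗ₜ v) := rfl

theorem shearOf_mul_tmul (f : H →ₗ[k] EnvelopingAlgebra k H) (z : EnvelopingAlgebra k H)
    (v : Hᵐᵒᵖ) : shearOf k H f (z * (1 ⊗ₜ v)) = shearOf k H f z * (1 ⊗ₜ v) := by
  induction z using TensorProduct.induction_on with
  | zero => simp
  | add x y hx hy => rw [add_mul, map_add, map_add, add_mul, hx, hy]
  | tmul a w => simp [mul_assoc]

theorem shearOf_comp_eq_id {f g : H →ₗ[k] EnvelopingAlgebra k H}
    (h : ∀ a, shearOf k H g (f a) = a ⊗ₜ 1) : shearOf k H g ∘ₗ shearOf k H f = LinearMap.id := by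
  ext a v
  simp [shearOf_mul_tmul, h]

variable (k H) in
/-- The bijection `a ⊗ v ↦ δ(a) (1 ⊗ v)` of the enveloping algebra, where `δ` is
`envelopingEmbedding`; its inverse is `a ⊗ v ↦ (a₁ ⊗ S²(a₂)) (1 ⊗ v)`. -/
noncomputable def envelopingShear : EnvelopingAlgebra k H ≃ₗ[k] EnvelopingAlgebra k H :=
  LinearEquiv.ofLinearMap (shearOf k H (envelopingEmbedding k H).toLinearMap)
    (shearOf k H (envelopingTwist k H))
    (shearOf_comp_eq_id fun a => by
      have r := Repr.arbitrary k a
      rw [envelopingTwist_eq_sum r, map_sum]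
      exact sum_envelopingEmbedding_mul r)
    (shearOf_comp_eq_id fun a => by
      have r := Repr.arbitrary k a
      rw [AlgHom.toLinearMap_apply, envelopingEmbedding_eq_sum r, map_sum]
      exact sum_envelopingTwist_mul r)

@[simp] theorem envelopingShear_tmul (a : H) (v : Hᵐᵒᵖ) :
    envelopingShear k H (a ⊗ₜ v) = envelopingEmbedding k H a * (1 ⊗ₜ v) := rfl

theorem envelopingShear_smul (h : H) (z : EnvelopingAlgebra k H) :
    envelopingShear k H (h • z) = envelopingEmbedding k H h * envelopingShear k H z := by
  induction z using TensorProduct.induction_on with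
  | zero => simp
  | add x y hx hy => rw [smul_add, map_add, map_add, mul_add, hx, hy]
  | tmul a w => rw [smul_tmul', smul_eq_mul]; simp [mul_assoc]


theorem envelopingShear_symm_mul (h : H) (z : EnvelopingAlgebra k H) :
    (envelopingShear k H).symm (envelopingEmbedding k H h * z) =
      h • (envelopingShear k H).symm z := by
  rw [LinearEquiv.symm_apply_eq, envelopingShear_smul, LinearEquiv.apply_symm_apply]

theorem Module.Basis.sum_repr_smul_eq_self_iff {R M ι : Type*} [Semiring R]
    [AddCommMonoid M] [Module R M] (b : Module.Basis ι R M) (s : Finset ι) (x : M) :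
    ∑ i ∈ s, b.repr x i • b i = x ↔ (b.repr x).support ⊆ s := by
  classical
  rw [← b.repr.injective.eq_iff, Finsupp.ext_iff]
  have h : ∀ j, b.repr (∑ i ∈ s, b.repr x i • b i) j = if j ∈ s then b.repr x j else 0 := by
    intro j
    simp [Finsupp.finsetSum_apply, Finsupp.single_apply]
  simp only [h, Finset.subset_iff, Finsupp.mem_support_iff, ite_eq_left_iff]
  exact forall_congr' fun j => by rw [eq_comm, not_imp_comm]

variable (k H) in
/-- The regular bimodule of the enveloping algebra, with its adjoint `H`-module structure. -/
noncomputable abbrev adjointRegular : ModuleCat.{u} H :=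
  (adjointFunctor k H).obj (ModuleCat.of _ (EnvelopingAlgebra k H))

variable (k) in
/-- The `H`-linear map `a ↦ δ(a) (1 ⊗ v)`. -/
noncomputable def toAdjointRegular (v : H) :
    ModuleCat.of H (ULift.{u} H) ⟶ adjointRegular k H :=
  ModuleCat.ofHom (Y := adjointRegular k H)
    { toFun := fun a => envelopingShear k H (a.down ⊗ₜ op v)
      map_add' := fun a b => by rw [ULift.add_down, add_tmul, map_add]; rfl
      map_smul' := fun h a => by
        rw [ULift.smul_down, ← smul_tmul', envelopingShear_smul]; rfl }

theorem toAdjointRegular_add (v w : H) :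
    toAdjointRegular k (v + w) = toAdjointRegular k v + toAdjointRegular k w := by
  ext a
  rw [ModuleCat.hom_add, LinearMap.add_apply]
  have h : envelopingShear k H (a.down ⊗ₜ op (v + w)) =
      envelopingShear k H (a.down ⊗ₜ op v) + envelopingShear k H (a.down ⊗ₜ op w) := by
    rw [MulOpposite.op_add, tmul_add, map_add]
  exact h

theorem rmulLinear_algebraMap_comp_toAdjointRegular (c : k) (v : H) :
    ModuleCat.ofHom (rmulLinear H (algebraMap k H c)) ≫ toAdjointRegular k v =
      toAdjointRegular k (c • v) := by
  ext a
  change envelopingShear k H ((a.down * algebraMap k H c) ⊗ₜ MulOpposite.op v) =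
    envelopingShear k H (_ ⊗ₜ MulOpposite.op (c • v))
  rw [← Algebra.commutes, ← Algebra.smul_def, MulOpposite.op_smul, tmul_smul, smul_tmul']

theorem toAdjointRegular_comp_toSpanSingleton (v x y : H) {ι : Type*} (r : Repr k x ι) :
    toAdjointRegular k v ≫ (adjointFunctor k H).map (ModuleCat.ofHom
      (LinearMap.toSpanSingleton _ (EnvelopingAlgebra k H) (x ⊗ₜ op y))) =
    ∑ i ∈ r.index, ModuleCat.ofHom (rmulLinear H (r.left i)) ≫ toAdjointRegular k
      (y * v * HopfAlgebra.antipode k (HopfAlgebra.antipode k (r.right i))) := by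
  ext a
  rw [ModuleCat.hom_sum, LinearMap.sum_apply]
  change envelopingShear k H (a.down ⊗ₜ MulOpposite.op v) * (x ⊗ₜ op y) =
    ∑ i ∈ r.index, envelopingShear k H ((a.down * r.left i) ⊗ₜ MulOpposite.op _)
  have h : (1 ⊗ₜ op v) * (x ⊗ₜ[k] op y : EnvelopingAlgebra k H) =
      (x ⊗ₜ 1) * (1 ⊗ₜ op (y * v)) := by simp
  rw [envelopingShear_tmul, mul_assoc, h, ← sum_envelopingEmbedding_mul r, Finset.sum_mul,
    Finset.mul_sum]
  refine Finset.sum_congr rfl fun i _ => ?_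
  rw [envelopingShear_tmul, map_mul]
  simp [mul_assoc]

variable {ι : Type*} (b : Module.Basis ι k H)

/-- The coordinate maps on the free `H`-module `adjointRegular k H` attached to a basis of `H`. -/
noncomputable def adjointRegularCoord (i : ι) :
    adjointRegular k H ⟶ ModuleCat.of H (ULift.{u} H) :=
  ModuleCat.ofHom (X := adjointRegular k H)
    { toFun := fun z => ⟨(Algebra.TensorProduct.basis H
        (b.map (opLinearEquiv k))).repr ((envelopingShear k H).symm z) i⟩
      map_add' := fun x y => by
        ext
        have h : (envelopingShear k H).symm (x + y) =
          (envelopingShear k H).symm x + (envelopingShear k H).symm y := map_add _ _ _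
        rw [h, map_add]; rfl
      map_smul' := fun h x => by
        have e : (envelopingShear k H).symm (h • x) = h • (envelopingShear k H).symm x :=
          envelopingShear_symm_mul h x
        exact congrArg (fun w => ULift.up ((Algebra.TensorProduct.basis H
          (b.map (opLinearEquiv k))).repr w i)) e |>.trans
            (congrArg ULift.up (by rw [map_smul]; rfl)) }

theorem toAdjointRegular_comp_adjointRegularCoord (v : H) (i : ι) :
    toAdjointRegular k v ≫ adjointRegularCoord b i =
      ModuleCat.ofHom (rmulLinear H (algebraMap k H (b.repr v i))) := by
  ext a
  change (Algebra.TensorProduct.basis H (b.map (opLinearEquiv k))).repr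
    ((envelopingShear k H).symm (envelopingShear k H (a.down ⊗ₜ MulOpposite.op v))) i =
      a.down * _
  rw [LinearEquiv.symm_apply_apply, Algebra.TensorProduct.basis_repr_tmul]
  simp

/-- The endomorphism of the free `H`-module `adjointRegular k H` keeping the coordinates in `s`. -/
noncomputable def adjointRegularTrunc (s : Finset ι) : adjointRegular k H ⟶ adjointRegular k H :=
  ∑ i ∈ s, adjointRegularCoord b i ≫ toAdjointRegular k (b i)

theorem adjointRegularTrunc_eq_self_iff (s : Finset ι) (z : adjointRegular k H) :
    (adjointRegularTrunc b s).hom z = z ↔ ((Algebra.TensorProduct.basis H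
      (b.map (opLinearEquiv k))).repr ((envelopingShear k H).symm z)).support ⊆ s := by
  set B := Algebra.TensorProduct.basis H (b.map (opLinearEquiv k)) with hB
  have h : (adjointRegularTrunc b s).hom z = envelopingShear k H
      (∑ i ∈ s, B.repr ((envelopingShear k H).symm z) i • B i) := by
    rw [adjointRegularTrunc, ModuleCat.hom_sum, LinearMap.sum_apply, map_sum]
    refine Finset.sum_congr rfl fun i _ => ?_
    change envelopingShear k H (_ ⊗ₜ MulOpposite.op (b i)) = _
    rw [hB, Algebra.TensorProduct.basis_apply, smul_tmul', smul_eq_mul, mul_one]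
    rfl
  rw [h, ← B.sum_repr_smul_eq_self_iff]
  exact (LinearEquiv.eq_symm_apply (envelopingShear k H)).symm

section Ext

open Abelian

variable {d : ℕ} {X : ModuleCat.{u} H} (e₀ : Ext X (ModuleCat.of H (ULift.{u} H)) d)

/-- The map `H → Ext^d (X, adjointRegular k H)` attached to a class `e₀ ∈ Ext^d (X, H)`,
sending `v` to the image of `e₀` under `a ↦ δ(a) (1 ⊗ v)`. -/
noncomputable def extToAdjointRegular : H →+ Ext X (adjointRegular k H) d :=
  AddMonoidHom.mk' (fun v => e₀.comp (Ext.mk₀ (toAdjointRegular k v)) (add_zero d))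
    fun v w => by rw [toAdjointRegular_add, Ext_mk₀_add, Ext.comp_add]

theorem extToAdjointRegular_apply (v : H) : extToAdjointRegular (k := k) e₀ v =
    e₀.comp (Ext.mk₀ (toAdjointRegular k v)) (add_zero d) := rfl

theorem extToAdjointRegular_smul (c : k) (v : H) : extToAdjointRegular e₀ (c • v) =
    (e₀.comp (Ext.mk₀ (ModuleCat.ofHom (rmulLinear H (algebraMap k H c)))) (add_zero d)).comp
      (Ext.mk₀ (toAdjointRegular k v)) (add_zero d) := by
  rw [Ext.comp_assoc_of_second_deg_zero, Ext.mk₀_comp_mk₀,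
    rmulLinear_algebraMap_comp_toAdjointRegular, extToAdjointRegular_apply]

theorem extToAdjointRegular_comp_adjointRegularCoord (v : H) (i : ι) :
    (extToAdjointRegular (k := k) e₀ v).comp (Ext.mk₀ (adjointRegularCoord b i)) (add_zero d) =
      e₀.comp (Ext.mk₀ (ModuleCat.ofHom (rmulLinear H (algebraMap k H (b.repr v i)))))
        (add_zero d) := by
  rw [extToAdjointRegular_apply, Ext.comp_assoc_of_second_deg_zero, Ext.mk₀_comp_mk₀,
    toAdjointRegular_comp_adjointRegularCoord]

theorem extToAdjointRegular_injective
    (hinj : ∀ c : k, e₀.comp (Ext.mk₀ (ModuleCat.ofHom (rmulLinear H (algebraMap k H c))))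
      (add_zero d) = 0 → c = 0) :
    Function.Injective (extToAdjointRegular (k := k) e₀) := by
  refine (injective_iff_map_eq_zero _).2 fun v hv => ?_
  let b := Module.Basis.ofVectorSpace k H
  refine b.repr.injective (Finsupp.ext fun i => ?_)
  rw [map_zero, Finsupp.zero_apply]
  refine hinj _ ?_
  rw [← extToAdjointRegular_comp_adjointRegularCoord, hv, Ext.zero_comp]

theorem extToAdjointRegular_surjective [IsNoetherianRing H] [Module.Finite H X]
    (hsurj : ∀ e, ∃ c : k, e =
      e₀.comp (Ext.mk₀ (ModuleCat.ofHom (rmulLinear H (algebraMap k H c)))) (add_zero d)) :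
    Function.Surjective (extToAdjointRegular (k := k) e₀) := by
  intro e
  let b := Module.Basis.ofVectorSpace k H
  obtain ⟨s, hs⟩ := exists_comp_eq_of_locally_id (adjointRegularTrunc b)
    (fun s t x hst hx => (adjointRegularTrunc_eq_self_iff b t x).2
      (((adjointRegularTrunc_eq_self_iff b s x).1 hx).trans hst))
    (fun x => ⟨_, (adjointRegularTrunc_eq_self_iff b _ x).2 subset_rfl⟩) d X e
  rw [← AddMonoidHom.mem_range, ← hs]
  have h : Ext.mk₀ (adjointRegularTrunc b s) =
      ∑ i ∈ s, Ext.mk₀ (adjointRegularCoord b i ≫ toAdjointRegular k (b i)) :=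
    map_sum (AddMonoidHom.mk' (Ext.mk₀ (X := adjointRegular k H) (Y := adjointRegular k H))
      Ext_mk₀_add) _ s
  have h' : e.comp (Ext.mk₀ (adjointRegularTrunc b s)) (add_zero d) = ∑ i ∈ s,
      (e.comp (Ext.mk₀ (adjointRegularCoord b i)) (add_zero d)).comp
        (Ext.mk₀ (toAdjointRegular k (b i))) (add_zero d) := by
    rw [h, ← Ext.bilinearComp_apply_apply, map_sum]
    refine Finset.sum_congr rfl fun i _ => ?_
    rw [Ext.bilinearComp_apply_apply, Ext.comp_assoc_of_second_deg_zero, Ext.mk₀_comp_mk₀]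
  rw [h']
  refine sum_mem fun i _ => ?_
  obtain ⟨c, hc⟩ := hsurj (e.comp (Ext.mk₀ (adjointRegularCoord b i)) (add_zero d))
  exact ⟨c • b i, by rw [hc, extToAdjointRegular_smul]⟩

theorem extToAdjointRegular_comp_toSpanSingleton (π : H →ₐ[k] k)
    (hπ : ∀ a, e₀.comp (Ext.mk₀ (ModuleCat.ofHom (rmulLinear H a))) (add_zero d) =
      e₀.comp (Ext.mk₀ (ModuleCat.ofHom (rmulLinear H (algebraMap k H (π a))))) (add_zero d))
    (v x y : H) :
    (extToAdjointRegular e₀ v).comp (Ext.mk₀ ((adjointFunctor k H).map (ModuleCat.ofHom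
      (LinearMap.toSpanSingleton _ (EnvelopingAlgebra k H) (x ⊗ₜ op y))))) (add_zero d) =
    extToAdjointRegular e₀ (y * v * HopfAlgebra.antipode k (HopfAlgebra.antipode k
      (leftWinding π x))) := by
  have r := Repr.arbitrary k x
  have hx : leftWinding π x = ∑ i ∈ r.index, π (r.left i) • r.right i := by
    simp [leftWinding, ← r.eq]
  have h := map_sum (AddMonoidHom.mk' (Ext.mk₀ (X := ModuleCat.of H (ULift.{u} H))
    (Y := adjointRegular k H)) Ext_mk₀_add)
      (fun i => ModuleCat.ofHom (rmulLinear H (r.left i)) ≫ toAdjointRegular k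
        (y * v * HopfAlgebra.antipode k (HopfAlgebra.antipode k (r.right i)))) r.index
  simp only [AddMonoidHom.mk'_apply] at h
  rw [extToAdjointRegular_apply, Ext.comp_assoc_of_second_deg_zero, Ext.mk₀_comp_mk₀,
    toAdjointRegular_comp_toSpanSingleton v x y r, h, ← Ext.bilinearComp_apply_apply, map_sum, hx]
  simp only [map_sum, map_smul, Finset.mul_sum, mul_smul_comm]
  refine Finset.sum_congr rfl fun i _ => ?_
  rw [extToAdjointRegular_smul, ← hπ, Ext.bilinearComp_apply_apply,
    Ext.comp_assoc_of_second_deg_zero, Ext.mk₀_comp_mk₀]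

end Ext

end Shear

section ExtSelfBimodule

open TensorProduct MulOpposite Coalgebra Abelian

variable {k : Type u'} [Field k] {H : Type u} [Ring H] [HopfAlgebra k H]

theorem bijective_comp_mapExactFunctor_adjointFunctor {X : ModuleCat.{u} H} (κ : X ≃+ k)
    (hκ : ∀ (h : H) (x : X), κ (h • x) = counit h * κ x)
    (N : ModuleCat.{u} (EnvelopingAlgebra k H)) (d : ℕ) :
    Function.Bijective fun e : Ext (selfBimodule k H) N d =>
      (Ext.mk₀ (trivialToSelfBimodule κ hκ)).comp (e.mapExactFunctor (adjointFunctor k H))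
        (zero_add d) :=
  bijective_comp_mapExactFunctor (adjointFunctor k H) (trivialToSelfBimodule κ hκ)
    (bijective_comp_trivialToSelfBimodule κ hκ) d N

/-- Restriction of bimodule extensions of the bimodule `H` along `adjointFunctor`, followed by
precomposition with the unit map of `H`. -/
noncomputable def extSelfBimoduleHom {X : ModuleCat.{u} H} (κ : X ≃+ k)
    (hκ : ∀ (h : H) (x : X), κ (h • x) = counit h * κ x)
    (N : ModuleCat.{u} (EnvelopingAlgebra k H)) (d : ℕ) :
    Ext (selfBimodule k H) N d →+ Ext X ((adjointFunctor k H).obj N) d :=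
  ((Ext.mk₀ (trivialToSelfBimodule κ hκ)).precomp _ (zero_add d)).comp
    ((adjointFunctor k H).mapExtAddHom (selfBimodule k H) N d)

/-- Bimodule extensions of the bimodule `H` are extensions of the trivial module by the adjoint
module. -/
noncomputable def extSelfBimoduleEquiv {X : ModuleCat.{u} H} (κ : X ≃+ k)
    (hκ : ∀ (h : H) (x : X), κ (h • x) = counit h * κ x)
    (N : ModuleCat.{u} (EnvelopingAlgebra k H)) (d : ℕ) :
    Ext (selfBimodule k H) N d ≃+ Ext X ((adjointFunctor k H).obj N) d :=
  AddEquiv.ofBijective (extSelfBimoduleHom κ hκ N d)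
    (bijective_comp_mapExactFunctor_adjointFunctor κ hκ N d)

theorem extSelfBimoduleEquiv_comp_mk₀ {X : ModuleCat.{u} H} (κ : X ≃+ k)
    (hκ : ∀ (h : H) (x : X), κ (h • x) = counit h * κ x)
    {N N' : ModuleCat.{u} (EnvelopingAlgebra k H)} {d : ℕ} (e : Ext (selfBimodule k H) N d)
    (f : N ⟶ N') : extSelfBimoduleEquiv κ hκ N' d (e.comp (Ext.mk₀ f) (add_zero d)) =
      (extSelfBimoduleEquiv κ hκ N d e).comp (Ext.mk₀ ((adjointFunctor k H).map f))
        (add_zero d) := by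
  change (Ext.mk₀ _).comp ((e.comp _ _).mapExactFunctor _) (zero_add d) =
    ((Ext.mk₀ _).comp _ (zero_add d)).comp _ _
  rw [Ext.mapExactFunctor_comp, Ext.mapExactFunctor_mk₀, Ext.comp_assoc_of_third_deg_zero]
  rfl

/-- If `e₀` is a basis of `Ext^d (k, H)` on which `H` acts from the right through the character
`π`, then `Ext^d (H, H ⊗ Hᵐᵒᵖ)` over the enveloping algebra is identified with `H`, with
`x ⊗ y` acting by `v ↦ y v S²(τ^l_π x)`. -/
theorem exists_addEquiv_ext_selfBimodule [IsNoetherianRing H] {d : ℕ} {X : ModuleCat.{u} H}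
    (κ : X ≃+ k) (hκ : ∀ (h : H) (x : X), κ (h • x) = counit h * κ x)
    (e₀ : Ext X (ModuleCat.of H (ULift.{u} H)) d)
    (hinj : ∀ c : k, e₀.comp (Ext.mk₀ (ModuleCat.ofHom (rmulLinear H (algebraMap k H c))))
      (add_zero d) = 0 → c = 0)
    (hsurj : ∀ e, ∃ c : k, e =
      e₀.comp (Ext.mk₀ (ModuleCat.ofHom (rmulLinear H (algebraMap k H c)))) (add_zero d))
    (π : H →ₐ[k] k)
    (hπ : ∀ a, e₀.comp (Ext.mk₀ (ModuleCat.ofHom (rmulLinear H a))) (add_zero d) =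
      e₀.comp (Ext.mk₀ (ModuleCat.ofHom (rmulLinear H (algebraMap k H (π a))))) (add_zero d)) :
    ∃ φ : H ≃+ Ext (selfBimodule k H) (ModuleCat.of _ (EnvelopingAlgebra k H)) d,
      ∀ v x y : H, φ (y * v * HopfAlgebra.antipode k (HopfAlgebra.antipode k (leftWinding π x))) =
        (φ v).comp (Ext.mk₀ (ModuleCat.ofHom
          (LinearMap.toSpanSingleton _ (EnvelopingAlgebra k H) (x ⊗ₜ op y)))) (add_zero d) := by
  have : Module.Finite H X := Module.Finite.of_surjective
    (LinearMap.toSpanSingleton H X (κ.symm 1)) fun x => ⟨algebraMap k H (κ x), by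
      apply κ.injective
      rw [LinearMap.toSpanSingleton_apply, hκ, Bialgebra.counit_algebraMap,
        AddEquiv.apply_symm_apply, mul_one]⟩
  let φ₁ := AddEquiv.ofBijective (extToAdjointRegular (k := k) e₀)
    ⟨extToAdjointRegular_injective e₀ hinj, extToAdjointRegular_surjective e₀ hsurj⟩
  let F := extSelfBimoduleEquiv κ hκ (ModuleCat.of _ (EnvelopingAlgebra k H)) d
  refine ⟨φ₁.trans F.symm, fun v x y => ?_⟩
  rw [AddEquiv.trans_apply, AddEquiv.symm_apply_eq,
    extSelfBimoduleEquiv_comp_mk₀, AddEquiv.trans_apply,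
    AddEquiv.apply_symm_apply]
  exact (extToAdjointRegular_comp_toSpanSingleton e₀ π hπ v x y).symm

end ExtSelfBimodule

section Coopposite

open TensorProduct Coalgebra

variable {k : Type u'} [Field k] {H : Type u} [Ring H] [HopfAlgebra k H]

/-- The co-opposite of a Hopf algebra with bijective antipode. -/
@[reducible]
noncomputable def coopHopfAlgebra
    (hS : Function.Bijective (HopfAlgebra.antipode k : H →ₗ[k] H)) : HopfAlgebra k H where
  comul := (TensorProduct.comm k H H).toLinearMap ∘ₗ comul
  counit := counit
  coassoc := by
    ext a
    have h := congrArg ((TensorProduct.assoc k H H H).toLinearMap ∘ₗ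
      (TensorProduct.comm k H (H ⊗[k] H)).toLinearMap ∘ₗ
      (TensorProduct.comm k H H).toLinearMap.lTensor H) (coassoc_apply (R := k) a)
    have r := Repr.arbitrary k a
    have e1 : ∀ (y : H) (w : H ⊗[k] H), y ⊗ₜ[k] TensorProduct.comm k H H w =
      TensorProduct.assoc k H H H (TensorProduct.comm k H (H ⊗[k] H)
        ((TensorProduct.comm k H H).toLinearMap.lTensor H
          (TensorProduct.assoc k H H H (w ⊗ₜ y)))) := by
      intro y w
      induction w using TensorProduct.induction_on with
      | zero => simp
      | tmul => simp
      | add w w' hw hw' => simp only [map_add, tmul_add, add_tmul, hw, hw']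
    rw [← r.eq] at h
    simp only [LinearMap.comp_apply, ← r.eq, map_sum, LinearEquiv.coe_coe, comm_tmul,
      LinearMap.rTensor_tmul, LinearMap.lTensor_tmul] at h ⊢
    simp only [e1]
    exact h.symm
  rTensor_counit_comp_comul := by
    ext a
    have r := Repr.arbitrary k a
    have h := congrArg (TensorProduct.comm k H k) (lTensor_counit_comul (R := k) a)
    simp only [← r.eq, map_sum, LinearMap.lTensor_tmul, comm_tmul] at h
    simpa only [LinearMap.comp_apply, ← r.eq, map_sum, LinearEquiv.coe_coe, comm_tmul,
      LinearMap.rTensor_tmul, mk_apply] using h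
  lTensor_counit_comp_comul := by
    ext a
    have r := Repr.arbitrary k a
    have h := congrArg (TensorProduct.comm k k H) (rTensor_counit_comul (R := k) a)
    simp only [← r.eq, map_sum, LinearMap.rTensor_tmul, comm_tmul] at h
    simpa only [LinearMap.comp_apply, ← r.eq, map_sum, LinearEquiv.coe_coe, comm_tmul,
      LinearMap.lTensor_tmul, LinearMap.flip_apply, mk_apply] using h
  counit_one := Bialgebra.counit_one
  mul_compr₂_counit := Bialgebra.mul_compr₂_counit
  comul_one := by simp [Algebra.TensorProduct.one_def]
  mul_compr₂_comul := by
    ext a b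
    simp only [LinearMap.compr₂_apply, LinearMap.compl₁₂_apply, LinearMap.comp_apply,
      LinearMap.mul_apply', Bialgebra.comul_mul]
    exact map_mul (Algebra.TensorProduct.comm k H H) (comul a) (comul b)
  antipode := (LinearEquiv.ofBijective (HopfAlgebra.antipode k) hS).symm.toLinearMap
  mul_antipode_rTensor_comul := by
    ext a
    have r := Repr.arbitrary k a
    apply hS.injective
    have h := HopfAlgebra.sum_antipode_mul_eq_algebraMap_counit r
    have e : ∀ x, HopfAlgebra.antipode k
        ((LinearEquiv.ofBijective (HopfAlgebra.antipode k) hS).symm x) = x :=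
      (LinearEquiv.ofBijective (HopfAlgebra.antipode k) hS).apply_symm_apply
    simp [← r.eq, HopfAlgebra.antipode_mul_antidistrib, e, h, Algebra.algebraMap_eq_smul_one]
  mul_antipode_lTensor_comul := by
    ext a
    have r := Repr.arbitrary k a
    apply hS.injective
    have h := HopfAlgebra.sum_mul_antipode_eq_algebraMap_counit r
    have e : ∀ x, HopfAlgebra.antipode k
        ((LinearEquiv.ofBijective (HopfAlgebra.antipode k) hS).symm x) = x :=
      (LinearEquiv.ofBijective (HopfAlgebra.antipode k) hS).apply_symm_apply
    simp [← r.eq, HopfAlgebra.antipode_mul_antidistrib, e, h, Algebra.algebraMap_eq_smul_one]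

theorem leftWinding_coopHopfAlgebra
    (hS : Function.Bijective (HopfAlgebra.antipode k : H →ₗ[k] H)) (π : H →ₐ[k] k) (h : H) :
    @leftWinding k H _ _ (coopHopfAlgebra hS).toBialgebra π h = rightWinding π h := by
  have r := Repr.arbitrary k h
  change TensorProduct.lid k H (TensorProduct.map π.toLinearMap LinearMap.id
    (TensorProduct.comm k H H (comul h))) = TensorProduct.rid k H (TensorProduct.map LinearMap.id
      π.toLinearMap (comul h))
  simp [← r.eq]

end Coopposite

section Winding

open Abelian

variable {k : Type u'} [Field k] {H : Type u} [Ring H] [HopfAlgebra k H]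

theorem leftWinding_one (π : H →ₐ[k] k) : leftWinding π 1 = 1 := by
  simp [leftWinding, Algebra.TensorProduct.one_def]

theorem rightWinding_one (π : H →ₐ[k] k) : rightWinding π 1 = 1 := by
  simp [rightWinding, Algebra.TensorProduct.one_def]

theorem exists_unit_antipode_leftWinding_mul {d : ℕ} [IsNoetherianRing H]
    (hS : Function.Bijective (HopfAlgebra.antipode k : H →ₗ[k] H)) {X : ModuleCat.{u} H}
    (κ : X ≃+ k) (hκ : ∀ (h : H) (x : X), κ (h • x) = Coalgebra.counit h * κ x)
    (e₀ : Ext X (ModuleCat.of H (ULift.{u} H)) d)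
    (hinj : ∀ c : k, e₀.comp (Ext.mk₀ (ModuleCat.ofHom (rmulLinear H (algebraMap k H c))))
      (add_zero d) = 0 → c = 0)
    (hsurj : ∀ e, ∃ c : k, e =
      e₀.comp (Ext.mk₀ (ModuleCat.ofHom (rmulLinear H (algebraMap k H c)))) (add_zero d))
    (π : H →ₐ[k] k)
    (hπ : ∀ a, e₀.comp (Ext.mk₀ (ModuleCat.ofHom (rmulLinear H a))) (add_zero d) =
      e₀.comp (Ext.mk₀ (ModuleCat.ofHom (rmulLinear H (algebraMap k H (π a))))) (add_zero d)) :
    ∃ u : Hˣ, ∀ h : H, ∃ t : H,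
      HopfAlgebra.antipode k (HopfAlgebra.antipode k t) = rightWinding π h ∧
      HopfAlgebra.antipode k (HopfAlgebra.antipode k (leftWinding π h)) * u = u * t := by
  obtain ⟨φ, hφ⟩ := exists_addEquiv_ext_selfBimodule κ hκ e₀ hinj hsurj π hπ
  obtain ⟨ψ, hψ⟩ := @exists_addEquiv_ext_selfBimodule k _ H _ (coopHopfAlgebra hS) _ d X
    κ hκ e₀ hinj hsurj π hπ
  let T := (LinearEquiv.ofBijective (HopfAlgebra.antipode k) hS).symm
  have hT : ∀ x, HopfAlgebra.antipode k (T x) = x :=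
    (LinearEquiv.ofBijective (HopfAlgebra.antipode k) hS).apply_symm_apply
  let θ : H ≃+ H := φ.trans ψ.symm
  have hθ : ∀ v x y : H,
      θ (y * v * HopfAlgebra.antipode k (HopfAlgebra.antipode k (leftWinding π x))) =
        y * θ v * T (T (rightWinding π x)) := by
    intro v x y
    rw [← leftWinding_coopHopfAlgebra hS]
    refine ψ.injective ?_
    refine Eq.trans ?_ (hψ (θ v) x y).symm
    have h (z : H) : ψ (θ z) = φ z := ψ.apply_symm_apply _
    rw [h, h]
    exact hφ v x y
  have hmul : ∀ y, θ y = y * θ 1 := by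
    intro y
    have hT1 : T 1 = 1 := hS.injective ((hT 1).trans HopfAlgebra.antipode_one.symm)
    simpa [leftWinding_one, rightWinding_one, hT1, HopfAlgebra.antipode_one] using hθ 1 1 y
  obtain ⟨w, hw⟩ := θ.surjective 1
  rw [hmul] at hw
  have hw' : θ 1 * w = 1 := θ.injective (by rw [hmul, mul_assoc, hw, mul_one])
  refine ⟨⟨θ 1, w, hw', hw⟩, fun h => ⟨T (T (rightWinding π h)), by rw [hT, hT], ?_⟩⟩
  have h1 := hθ 1 h 1
  rwa [one_mul, one_mul, one_mul, hmul] at h1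

end Winding

theorem antipode_fourth_power_eq_inner_comp_windings
    (k : Type u) [Field k] (H : Type u) [Ring H] [HopfAlgebra k H]
    (hS : Function.Bijective (HopfAlgebra.antipode k : H →ₗ[k] H))
    (hnoeth : IsNoetherianRing H) (hnoeth' : IsNoetherianRing Hᵐᵒᵖ)
    -- `H` is AS-Gorenstein, with injective dimension `d`:
    (d : ℕ)
    (hinj : selfInjectiveDimension H = (d : ℕ∞))
    (hinj' : selfInjectiveDimension Hᵐᵒᵖ = (d : ℕ∞))
    (hvanish : ∀ i : ℕ, i ≠ d → Subsingleton (ExtGroup H (TrivialCounitModule k H) H i))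
    (hdim : Module.finrank k (ExtGroup H (TrivialCounitModule k H) H d) = 1)
    -- `π : H → k` is the algebra map whose kernel is the right annihilator of the
    -- left integral `∫^l_H = Ext^d_H (k, H)`:
    (π : H →ₐ[k] k)
    (hπ : ∀ h : H, π h = 0 ↔
      ∀ e : ExtGroup H (TrivialCounitModule k H) H d, MulOpposite.op h • e = 0) :
    -- conclusion: `S⁴ ∘ τ^l_π` is `τ^r_π` composed with an inner automorphism:
    ∃ u : Hˣ, ∀ h : H,
      HopfAlgebra.antipode (R := k) (HopfAlgebra.antipode (R := k)
        (HopfAlgebra.antipode (R := k) (HopfAlgebra.antipode (R := k)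
          (leftWinding π h)))) = u * rightWinding π h * ↑u⁻¹ := by
  obtain ⟨e₀, he₀, hspan⟩ := finrank_eq_one_iff'.1 hdim
  have hsmul : ∀ (c : k) (e : ExtGroup H (TrivialCounitModule k H) H d),
      c • e = MulOpposite.op (algebraMap k H c) • e := by
    intro c e
    have h : scalarLinear k H H c = rmulLinear H (algebraMap k H c) := by
      ext x
      exact Algebra.commutes c x.down
    change e.comp (Abelian.Ext.mk₀ (ModuleCat.ofHom (scalarLinear k H H c))) (add_zero d) =
      e.comp (Abelian.Ext.mk₀ (ModuleCat.ofHom (rmulLinear H (algebraMap k H c)))) (add_zero d)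
    rw [h]
  obtain ⟨u, hu⟩ := exists_unit_antipode_leftWinding_mul (k := k) hS
    (X := ModuleCat.of H (ULift.{u} (TrivialCounitModule k H)))
    (AddEquiv.ulift (α := TrivialCounitModule k H)) (fun h x => rfl) e₀
    (fun c hc => by
      by_contra hne
      have h : c • e₀ = 0 := (hsmul c e₀).trans hc
      exact (smul_ne_zero hne he₀) h)
    (fun e => by
      obtain ⟨c, hc⟩ := hspan e
      exact ⟨c, hc.symm.trans (hsmul c e₀)⟩) π
    (fun a => by
      have h := (hπ (a - algebraMap k H (π a))).1 (by simp) e₀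
      rw [MulOpposite.op_sub, sub_smul, sub_eq_zero] at h
      exact h)
  let v : Hˣ :=
    { val := HopfAlgebra.antipode k (HopfAlgebra.antipode k u.val)
      inv := HopfAlgebra.antipode k (HopfAlgebra.antipode k u.inv)
      val_inv := by
        rw [← HopfAlgebra.antipode_mul_antidistrib, ← HopfAlgebra.antipode_mul_antidistrib]
        simp [HopfAlgebra.antipode_one]
      inv_val := by
        rw [← HopfAlgebra.antipode_mul_antidistrib, ← HopfAlgebra.antipode_mul_antidistrib]
        simp [HopfAlgebra.antipode_one] }
  refine ⟨v, fun h => ?_⟩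
  obtain ⟨t, ht, hut⟩ := hu h
  have e := congrArg (fun x => HopfAlgebra.antipode k (HopfAlgebra.antipode k x)) hut
  simp only [HopfAlgebra.antipode_mul_antidistrib, ht] at e
  exact (Units.eq_mul_inv_iff_mul_eq v).2 e
end

section
/- (Skryabin) Let k be a field and let H be a noetherian Hopf algebra over k which is either semiprime, or affine and satisfies a polynomial identity. Then the antipode S of H is bijective. -/
/-!
STATEMENT 18 (Skryabin):
If `H` is a noetherian Hopf algebra over a field which is either semiprime, or
affine and satisfying a polynomial identity, then its antipode is bijective.
(Bijectivity of the antipode is of course not assumed.)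
-/

universe u

/-- An algebra `A` over `k` satisfies a polynomial identity if there is a nonzero
polynomial `f` in finitely many noncommuting variables, with coefficients in `k`,
which vanishes identically on `A`. -/
def SatisfiesPolynomialIdentity (k : Type u) (A : Type u) [CommSemiring k] [Ring A]
    [Algebra k A] : Prop :=
  ∃ (n : ℕ) (f : FreeAlgebra k (Fin n)), f ≠ 0 ∧
    ∀ v : Fin n → A, FreeAlgebra.lift k v f = 0

/-- A ring is semiprime if it has no nonzero nilpotent two-sided ideals;
equivalently, `a R a = 0` implies `a = 0`. -/
def IsSemiprimeRing (R : Type u) [Ring R] : Prop :=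
  ∀ a : R, (∀ x : R, a * x * a = 0) → a = 0

open TensorProduct Coalgebra

/-- A square matrix over a coalgebra which behaves like the matrix of coefficients of a
finite-dimensional comodule. -/
structure IsComoduleMatrix (k : Type*) {H : Type*} [Field k] [AddCommGroup H] [Module k H]
    [Coalgebra k H] {n : ℕ} (X : Matrix (Fin n) (Fin n) H) : Prop where
  comul_apply (i j : Fin n) : comul (R := k) (X i j) = ∑ l, X i l ⊗ₜ[k] X l j
  counit_apply (i j : Fin n) : counit (R := k) (X i j) = (1 : Matrix (Fin n) (Fin n) k) i j

section Coalgebra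

variable {k C : Type*} [Field k] [AddCommGroup C] [Module k C] [Coalgebra k C]

theorem comul_rid_lTensor (φ : C →ₗ[k] k) (t : C ⊗[k] C) :
    comul (R := k) (TensorProduct.rid k C (φ.lTensor C t)) =
      ((TensorProduct.rid k C).toLinearMap ∘ₗ φ.lTensor C).lTensor C
        (TensorProduct.assoc k C C C ((comul (R := k)).rTensor C t)) := by
  induction t with
  | zero => simp
  | add t u ht hu => simp only [map_add, ht, hu]
  | tmul a b =>
    simp only [LinearMap.lTensor_tmul, LinearMap.rTensor_tmul, TensorProduct.rid_tmul, map_smul]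
    induction comul (R := k) a with
    | zero => simp
    | add t u ht hu => rw [TensorProduct.add_tmul, map_add, map_add, ← ht, ← hu, smul_add]
    | tmul c d => simp

theorem lid_rTensor_comul (φ : C →ₗ[k] k) (t : C ⊗[k] C) :
    comul (R := k) (TensorProduct.lid k C (φ.rTensor C t)) =
      TensorProduct.lid k (C ⊗[k] C) (φ.rTensor (C ⊗[k] C) ((comul (R := k)).lTensor C t)) := by
  induction t with
  | zero => simp
  | add t u ht hu => simp only [map_add, ht, hu]
  | tmul a b => simp

/-- Every element of a coalgebra lies in a finite-dimensional right coideal. -/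
theorem exists_finite_right_coideal (x : C) :
    ∃ V : Submodule k C, Module.Finite k V ∧ x ∈ V ∧
      ∀ v ∈ V, comul (R := k) v ∈ LinearMap.range (V.subtype.rTensor C) := by
  classical
  let b := Module.Free.chooseBasis k C
  obtain ⟨c, hc⟩ := TensorProduct.eq_repr_basis_right b (comul (R := k) x)
  have hc' (i) : c i = TensorProduct.rid k C ((b.coord i).lTensor C (comul (R := k) x)) := by
    rw [← TensorProduct.equivFinsuppOfBasisRight_apply, ← hc,
      ← TensorProduct.equivFinsuppOfBasisRight_symm_apply, LinearEquiv.apply_symm_apply]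
  refine ⟨Submodule.span k (Set.range c), .span_of_finite _ c.finite_range, ?_, ?_⟩
  · have h := congr(TensorProduct.rid k C ((counit (R := k)).lTensor C $hc))
    rw [lTensor_counit_comul] at h
    simp only [Finsupp.sum, map_sum, LinearMap.lTensor_tmul, TensorProduct.rid_tmul,
      one_smul] at h
    rw [← h]
    exact Submodule.sum_mem _ fun i _ ↦ Submodule.smul_mem _ _ (Submodule.subset_span ⟨i, rfl⟩)
  · intro v hv
    induction hv using Submodule.span_induction with
    | mem v hv =>
      obtain ⟨i, rfl⟩ := hv
      rw [hc', comul_rid_lTensor, coassoc_apply, ← hc]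
      simp only [Finsupp.sum, map_sum, LinearMap.lTensor_tmul]
      exact Submodule.sum_mem _ fun j _ ↦
        ⟨⟨c j, Submodule.subset_span ⟨j, rfl⟩⟩ ⊗ₜ _, by rw [LinearMap.rTensor_tmul]; rfl⟩
    | zero => simp
    | add v w _ _ hv hw => rw [map_add]; exact add_mem hv hw
    | smul a v _ hv => rw [map_smul]; exact Submodule.smul_mem _ _ hv

/-- Every element of a coalgebra is a linear combination of the coefficients of a
finite-dimensional comodule. -/
theorem exists_isComoduleMatrix (x : C) :
    ∃ (n : ℕ) (X : Matrix (Fin n) (Fin n) C), IsComoduleMatrix k X ∧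
      ∃ a : Fin n → Fin n → k, x = ∑ i, ∑ j, a i j • X i j := by
  obtain ⟨V, _, hx, hV⟩ := exists_finite_right_coideal (k := k) x
  let w := Module.finBasis k V
  have hsum (v : V) : ∑ i, w.repr v i • (w i : C) = v := by
    conv_rhs => rw [← w.sum_repr v]
    push_cast
    rfl
  obtain ⟨p, hp⟩ := V.subtype.exists_leftInverse_of_injective (by simp)
  have hp' (v : V) : p v = v := congr($hp v)
  let f (i) : C →ₗ[k] k := w.coord i ∘ₗ p
  let X : Matrix (Fin (Module.finrank k V)) (Fin (Module.finrank k V)) C := .of fun i j ↦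
    TensorProduct.lid k C ((f i).rTensor C (comul (R := k) (w j : C)))
  have hw (v : V) : comul (R := k) (v : C) =
      ∑ i, (w i : C) ⊗ₜ TensorProduct.lid k C ((f i).rTensor C (comul (R := k) (v : C))) := by
    obtain ⟨t, ht⟩ := hV v v.2
    rw [← ht]
    clear ht
    induction t with
    | zero => simp
    | add t u ht hu =>
      simp only [map_add, TensorProduct.tmul_add, Finset.sum_add_distrib]
      rw [← ht, ← hu]
    | tmul v c =>
      simp only [LinearMap.rTensor_tmul, Submodule.subtype_apply, TensorProduct.lid_tmul, f,
        LinearMap.comp_apply, hp', ← TensorProduct.smul_tmul, ← TensorProduct.sum_tmul]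
      congr 1
      simpa using (hsum v).symm
  have hf (i j) : f i (w j) = (1 : Matrix _ _ k) i j := by
    simp [f, hp', Finsupp.single_apply, Matrix.one_apply, eq_comm]
  have hwX (j) : comul (R := k) (w j : C) = ∑ i, (w i : C) ⊗ₜ X i j := hw (w j)
  have hε (v : C) : TensorProduct.rid k C ((counit (R := k)).lTensor C (comul v)) = v := by
    simp
  refine ⟨_, X, ⟨fun i j ↦ ?_, fun i j ↦ ?_⟩, ?_⟩
  · have h : X i j = TensorProduct.lid k C ((f i).rTensor C (comul (R := k) (w j : C))) := rfl
    rw [h, lid_rTensor_comul, ← coassoc_apply, hwX]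
    simp [hwX, TensorProduct.sum_tmul, hf, Matrix.one_apply]
  · have h : X i j = TensorProduct.lid k C ((f i).rTensor C (comul (R := k) (w j : C))) := rfl
    rw [← hf, h]
    conv_rhs => rw [← hε (w j)]
    induction comul (R := k) (w j : C) with
    | zero => simp
    | add t u ht hu => simp only [map_add, ht, hu]
    | tmul a b => simp [mul_comm]
  · refine ⟨fun i j ↦ counit (R := k) (w i : C) * w.repr ⟨x, hx⟩ j, ?_⟩
    have h (j) : (w j : C) = ∑ i, counit (R := k) (w i : C) • X i j := by
      have := congr(TensorProduct.lid k C ((counit (R := k)).rTensor C $(hwX j)))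
      simpa using this
    rw [Finset.sum_comm]
    refine (hsum ⟨x, hx⟩).symm.trans ?_
    refine Finset.sum_congr rfl fun j _ ↦ ?_
    rw [h j, Finset.smul_sum]
    simp [smul_smul, mul_comm]

end Coalgebra

section Antipode

open HopfAlgebra

variable {k H : Type*} [Field k] [Ring H] [HopfAlgebra k H] {n : ℕ}
  {X : Matrix (Fin n) (Fin n) H}

namespace IsComoduleMatrix

theorem mul_map_antipode (hX : IsComoduleMatrix k X) : X * X.map (antipode k) = 1 := by
  ext i j
  have h := mul_antipode_lTensor_comul_apply (R := k) (X i j)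
  rw [hX.comul_apply, hX.counit_apply] at h
  simpa [Matrix.mul_apply, Matrix.one_apply, apply_ite] using h

theorem map_antipode_mul (hX : IsComoduleMatrix k X) : X.map (antipode k) * X = 1 := by
  ext i j
  have h := mul_antipode_rTensor_comul_apply (R := k) (X i j)
  rw [hX.comul_apply, hX.counit_apply] at h
  simpa [Matrix.mul_apply, Matrix.one_apply, apply_ite] using h

theorem comul_antipode_apply (hX : IsComoduleMatrix k X) (i j : Fin n) :
    comul (R := k) (antipode k (X i j)) =
      ∑ l, antipode k (X l j) ⊗ₜ[k] antipode k (X i l) := by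
  let L := (Algebra.TensorProduct.includeLeft : H →ₐ[k] H ⊗[k] H).mapMatrix (m := Fin n)
  let R := (Algebra.TensorProduct.includeRight : H →ₐ[k] H ⊗[k] H).mapMatrix (m := Fin n)
  let D := (Bialgebra.comulAlgHom k H).mapMatrix (m := Fin n)
  have hD : D X = L X * R X := by
    ext i j
    simp [D, L, R, Matrix.mul_apply, hX.comul_apply]
  have h₁ : (R (X.map (antipode k)) * L (X.map (antipode k))) * D X = 1 := by
    rw [hD, mul_assoc, ← mul_assoc _ (L X), ← map_mul, hX.map_antipode_mul, map_one, one_mul,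
      ← map_mul, hX.map_antipode_mul, map_one]
  have h₂ : D X * D (X.map (antipode k)) = 1 := by
    rw [← map_mul, hX.mul_map_antipode, map_one]
  have h := congr($(left_inv_eq_right_inv h₁ h₂) i j)
  simpa [D, L, R, Matrix.mul_apply] using h.symm

/-- A left inverse of the transpose of a comodule matrix puts its coefficients in the range of
the antipode. -/
theorem mem_range_antipode (hX : IsComoduleMatrix k X) {t : Matrix (Fin n) (Fin n) H}
    (ht : t * X.transpose = 1) (i j : Fin n) : X i j ∈ LinearMap.range (antipode k (A := H)) := by
  have h : X.map (antipode k) * (t.map (antipode k)).transpose = 1 := by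
    ext i j
    have h := congr(antipode k ($ht j i))
    simpa [Matrix.mul_apply, Matrix.one_apply, apply_ite, antipode_mul_antidistrib,
      antipode_one, eq_comm] using h
  rw [left_inv_eq_right_inv hX.mul_map_antipode h]
  exact ⟨_, rfl⟩

end IsComoduleMatrix

theorem antipode_surjective_of_forall_isComoduleMatrix
    (h : ∀ (n : ℕ) (X : Matrix (Fin n) (Fin n) H), IsComoduleMatrix k X →
      ∃ t : Matrix (Fin n) (Fin n) H, t * X.transpose = 1) :
    Function.Surjective (antipode k : H →ₗ[k] H) := by
  intro x
  obtain ⟨n, X, hX, a, rfl⟩ := exists_isComoduleMatrix (k := k) x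
  obtain ⟨t, ht⟩ := h n X hX
  change _ ∈ LinearMap.range (antipode k (A := H))
  exact Submodule.sum_mem _ fun i _ ↦ Submodule.sum_mem _ fun j _ ↦
    Submodule.smul_mem _ _ (hX.mem_range_antipode ht i j)

theorem IsComoduleMatrix.exists_apply_antipode [IsNoetherianRing H] (hX : IsComoduleMatrix k X) :
    ∃ g : H →ₗ[k] H, ∀ i j, X i j = g (antipode k (X i j)) := by
  let W : Submodule H (Matrix (Fin n) (Fin n) H) :=
    { carrier := {F | ∃ g : H →ₗ[k] H, ∀ i j, F i j = g (antipode k (X i j))}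
      zero_mem' := ⟨0, by simp⟩
      add_mem' := by
        rintro F G ⟨f, hf⟩ ⟨g, hg⟩
        exact ⟨f + g, by simp [hf, hg]⟩
      smul_mem' := by
        rintro a F ⟨f, hf⟩
        exact ⟨LinearMap.mulLeft k a ∘ₗ f, by simp [hf]⟩ }
  have hW₁ : 1 ∈ W := ⟨Algebra.linearMap k H ∘ₗ counit, fun i j ↦ by
    by_cases h : i = j <;> simp [hX.counit_apply, Matrix.one_apply, h]⟩
  have hW (F) (hF : F ∈ W) : F * X.map (antipode k) ∈ W := by
    obtain ⟨g, hg⟩ := hF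
    refine ⟨LinearMap.mul' k H ∘ₗ g.rTensor H ∘ₗ (TensorProduct.comm k H H).toLinearMap ∘ₗ comul,
      fun i j ↦ ?_⟩
    simp [hX.comul_antipode_apply, Matrix.mul_apply, hg]
  let r (A : Matrix (Fin n) (Fin n) H) :
      Matrix (Fin n) (Fin n) H →ₗ[H] Matrix (Fin n) (Fin n) H :=
    { toFun F := F * A
      map_add' _ _ := add_mul _ _ _
      map_smul' _ _ := Matrix.smul_mul _ _ _ }
  have : IsNoetherian H (Matrix (Fin n) (Fin n) H) :=
    inferInstanceAs (IsNoetherian H (Fin n → Fin n → H))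
  let V : ℕ →o Submodule H (Matrix (Fin n) (Fin n) H) :=
    ⟨fun m ↦ W.comap (r (X.map (antipode k) ^ m)), monotone_nat_of_le_succ fun m F hF ↦ by
      have := hW _ hF
      simpa [r, pow_succ, mul_assoc] using this⟩
  obtain ⟨m, hm⟩ := monotone_stabilizes_iff_noetherian.mpr this V
  have hpow (m : ℕ) : X ^ m * X.map (antipode k) ^ m = 1 := by
    induction m with
    | zero => simp
    | succ m ih =>
      rw [pow_succ, pow_succ', mul_assoc, ← mul_assoc X, hX.mul_map_antipode, one_mul, ih]
  have h : X ^ (m + 1) ∈ V (m + 1) := by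
    change X ^ (m + 1) * X.map (antipode k) ^ (m + 1) ∈ W
    rwa [hpow]
  rw [← hm _ m.le_succ] at h
  change X ^ (m + 1) * X.map (antipode k) ^ m ∈ W at h
  rwa [pow_succ', mul_assoc, hpow, mul_one] at h

theorem antipode_injective_of_isNoetherianRing [IsNoetherianRing H] :
    Function.Injective (antipode k : H →ₗ[k] H) := by
  refine (injective_iff_map_eq_zero _).mpr fun x hx ↦ ?_
  obtain ⟨n, X, hX, a, rfl⟩ := exists_isComoduleMatrix (k := k) x
  obtain ⟨g, hg⟩ := hX.exists_apply_antipode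
  have := congrArg g hx
  simpa [← hg] using this

end Antipode

section Semiprime

theorem IsSemiprimeRing.eq_zero_of_essential {R : Type*} [Ring R] [IsNoetherianRing R]
    (hR : IsSemiprimeRing R) {x : R} (hx : ∀ b : R, b ≠ 0 → ∃ r, r * b ≠ 0 ∧ r * b * x = 0) :
    x = 0 := by
  by_contra hx0
  let ann (a : R) : Submodule R R := LinearMap.ker (LinearMap.toSpanSingleton R R a)
  have hann (a r : R) : r ∈ ann a ↔ r * a = 0 := by simp [ann]
  let Z : Set R := {a | a ≠ 0 ∧ ∀ b : R, b ≠ 0 → ∃ r, r * b ≠ 0 ∧ r * b * a = 0}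
  obtain ⟨_, ⟨a, ⟨ha0, ha⟩, rfl⟩, hmax⟩ :=
    set_has_maximal_iff_noetherian.mpr ‹IsNoetherianRing R› (ann '' Z) ⟨_, x, ⟨hx0, hx⟩, rfl⟩
  refine ha0 (hR a fun y ↦ by_contra fun hy ↦ ?_)
  obtain ⟨r, hr, hr'⟩ := ha (a * y) fun h ↦ hy (by rw [h, zero_mul])
  refine hmax (ann (a * y * a)) ⟨_, ⟨hy, fun b hb ↦ ?_⟩, rfl⟩
    (lt_of_le_of_ne (fun s hs ↦ ?_) fun h ↦ ?_)
  · obtain ⟨s, hs, hs'⟩ := ha b hb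
    exact ⟨s, hs, by rw [← mul_assoc, ← mul_assoc, hs', zero_mul, zero_mul]⟩
  · rw [hann] at hs ⊢
    rw [← mul_assoc, ← mul_assoc, hs, zero_mul, zero_mul]
  · have : r ∈ ann a := by rw [h, hann, ← mul_assoc, hr']
    rw [hann] at this
    exact hr (by rw [← mul_assoc, this, zero_mul])

theorem IsSemiprimeRing.eq_zero_of_mul_eq_smul_one {R : Type*} [Ring R] [IsNoetherianRing R]
    (hR : IsSemiprimeRing R) {n : ℕ} {Y : Matrix (Fin n) (Fin n) R}
    (hY : ∀ F : Matrix (Fin n) (Fin n) R, F * Y = 0 → F = 0) {x : R}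
    (hx : ∀ (d : R) (F : Matrix (Fin n) (Fin n) R), F * Y = d • 1 → d * x = 0) : x = 0 := by
  refine hR.eq_zero_of_essential fun b hb ↦ ?_
  have : IsNoetherian R (Matrix (Fin n) (Fin n) R) :=
    inferInstanceAs (IsNoetherian R (Fin n → Fin n → R))
  let f : Matrix (Fin n) (Fin n) R × Submodule.span R {b} →ₗ[R] Matrix (Fin n) (Fin n) R :=
    { toFun p := p.1 * Y + (p.2 : R) • 1
      map_add' p q := by
        simp only [Prod.fst_add, Prod.snd_add, add_mul, Submodule.coe_add, add_smul]
        abel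
      map_smul' r p := by simp [smul_smul] }
  by_cases hf : Function.Injective f
  · have := IsNoetherian.subsingleton_of_prod_injective f hf
    have := congrArg Subtype.val (Subsingleton.elim
      (⟨b, Submodule.mem_span_singleton_self b⟩ : Submodule.span R {b}) 0)
    exact absurd this hb
  · rw [injective_iff_map_eq_zero] at hf
    push Not at hf
    obtain ⟨⟨F, c, hc⟩, hFc, h0⟩ := hf
    obtain ⟨r, rfl⟩ := Submodule.mem_span_singleton.mp hc
    have hFc' : -F * Y = (r * b) • 1 := by
      rw [neg_mul, neg_eq_iff_add_eq_zero]
      exact hFc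
    refine ⟨r, fun hrb ↦ h0 ?_, hx _ _ hFc'⟩
    rw [hrb, zero_smul] at hFc'
    have := hY _ hFc'
    ext1
    · exact neg_eq_zero.mp this
    · exact Subtype.ext hrb

theorem IsSemiprimeRing.op {R : Type*} [Ring R] (hR : IsSemiprimeRing R) :
    IsSemiprimeRing Rᵐᵒᵖ := fun a ha ↦
  MulOpposite.unop_injective (hR _ fun x ↦ by
    simpa [mul_assoc] using congrArg MulOpposite.unop (ha (.op x)))

end Semiprime

section ScalarLeftInverse

open HopfAlgebra

variable {k H : Type*} [Field k] [Ring H] [HopfAlgebra k H] {n : ℕ}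
  {X : Matrix (Fin n) (Fin n) H}

theorem IsComoduleMatrix.eq_zero_of_mul_transpose_eq_zero (hX : IsComoduleMatrix k X)
    (hS : Function.Injective (antipode k : H →ₗ[k] H)) {F : Matrix (Fin n) (Fin n) H}
    (hF : F * X.transpose = 0) : F = 0 := by
  have h : X.map (antipode k) * (F.map (antipode k)).transpose = 0 := by
    ext i j
    simpa [Matrix.mul_apply, antipode_mul_antidistrib] using congr(antipode k ($hF j i))
  have h' : (F.map (antipode k)).transpose = 0 := by
    rw [← one_mul (F.map (antipode k)).transpose, ← hX.mul_map_antipode, mul_assoc, h, mul_zero]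
  ext i j
  exact hS (by simpa using congr($h' j i))

theorem IsComoduleMatrix.eq_zero_of_transpose_mul_eq_zero (hX : IsComoduleMatrix k X)
    (hS : Function.Injective (antipode k : H →ₗ[k] H)) {Z : Matrix (Fin n) (Fin n) H}
    (hZ : X.transpose * Z = 0) : Z = 0 := by
  have h : (Z.map (antipode k)).transpose * X.map (antipode k) = 0 := by
    ext i j
    simpa [Matrix.mul_apply, antipode_mul_antidistrib] using congr(antipode k ($hZ j i))
  have h' : (Z.map (antipode k)).transpose = 0 := by
    rw [← mul_one (Z.map (antipode k)).transpose, ← hX.map_antipode_mul, ← mul_assoc, h, zero_mul]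
  ext i j
  exact hS (by simpa using congr($h' j i))

theorem IsComoduleMatrix.eq_zero_of_mul_scalar_eq_zero [IsNoetherianRing Hᵐᵒᵖ]
    (hH : IsSemiprimeRing H) (hX : IsComoduleMatrix k X)
    (hS : Function.Injective (antipode k : H →ₗ[k] H)) {x : H}
    (hx : ∀ (h : H) (Z : Matrix (Fin n) (Fin n) H), X.transpose * Z = .diagonal (fun _ ↦ h) →
      x * h = 0) : x = 0 := by
  refine MulOpposite.op_injective ?_
  refine hH.op.eq_zero_of_mul_eq_smul_one (Y := X.map MulOpposite.op) (fun F hF ↦ ?_)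
    fun d F hF ↦ ?_
  · have h := hX.eq_zero_of_transpose_mul_eq_zero hS (Z := (F.map MulOpposite.unop).transpose) (by
      ext i j
      simpa [Matrix.mul_apply] using congr(MulOpposite.unop ($hF j i)))
    ext i j
    simpa using congr($h j i)
  · have := hx d.unop (F.map MulOpposite.unop).transpose (by
      ext i j
      by_cases hij : i = j
      · subst hij
        simpa [Matrix.mul_apply] using congr(MulOpposite.unop ($hF i i))
      · simpa [Matrix.mul_apply, hij, Ne.symm hij] using congr(MulOpposite.unop ($hF j i)))
    exact MulOpposite.unop_injective (by simpa using this)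

end ScalarLeftInverse

section Twist

open HopfAlgebra

variable {k H Φ : Type*} [Field k] [Ring H] [HopfAlgebra k H] [Ring Φ] [Algebra k Φ]

/-- The endomorphism `φ ⊗ x ↦ (φ ⊗ 1) (κ ⊗ 1) (τ x)` of `Φ ⊗ H`. -/
noncomputable def twist (κ : H →ₐ[k] Φ) (τ : H →ₗ[k] H ⊗[k] H) : Φ ⊗[k] H →ₗ[k] Φ ⊗[k] H :=
  LinearMap.mul' k (Φ ⊗[k] H) ∘ₗ TensorProduct.map
    (Algebra.TensorProduct.includeLeft : Φ →ₐ[k] Φ ⊗[k] H).toLinearMap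
    (κ.toLinearMap.rTensor H ∘ₗ τ)

@[simp]
theorem twist_tmul (κ : H →ₐ[k] Φ) (τ : H →ₗ[k] H ⊗[k] H) (φ : Φ) (x : H) :
    twist κ τ (φ ⊗ₜ x) = φ ⊗ₜ 1 * κ.toLinearMap.rTensor H (τ x) := by
  simp [twist]

theorem mul_rTensor_mem_range {N : Submodule k Φ} {κ : H →ₐ[k] Φ}
    (hN : ∀ y ∈ N, ∀ a, y * κ a ∈ N) {ω : Φ ⊗[k] H}
    (hω : ω ∈ LinearMap.range (N.subtype.rTensor H)) (v : H ⊗[k] H) :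
    ω * κ.toLinearMap.rTensor H v ∈ LinearMap.range (N.subtype.rTensor H) := by
  obtain ⟨t, rfl⟩ := hω
  induction v with
  | zero => simp
  | add v w hv hw => rw [map_add, mul_add]; exact add_mem hv hw
  | tmul a b =>
    induction t with
    | zero => simp
    | add t u ht hu => rw [map_add, add_mul]; exact add_mem ht hu
    | tmul y x => exact ⟨⟨_, hN y y.2 a⟩ ⊗ₜ (x * b), by simp⟩

theorem twist_mem_range {N : Submodule k Φ} {κ : H →ₐ[k] Φ} (hN : ∀ y ∈ N, ∀ a, y * κ a ∈ N)
    (τ : H →ₗ[k] H ⊗[k] H) {ω : Φ ⊗[k] H} (hω : ω ∈ LinearMap.range (N.subtype.rTensor H)) :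
    twist κ τ ω ∈ LinearMap.range (N.subtype.rTensor H) := by
  obtain ⟨t, rfl⟩ := hω
  induction t with
  | zero => simp
  | add t u ht hu => rw [map_add, map_add]; exact add_mem ht hu
  | tmul y x =>
    rw [LinearMap.rTensor_tmul, twist_tmul]
    exact mul_rTensor_mem_range hN ⟨y ⊗ₜ 1, by simp⟩ _

theorem mem_range_rTensor_of_mul_mem {N : Submodule k Φ} {E : Set H}
    (hE : ∀ x : H, (∀ h ∈ E, x * h = 0) → x = 0) {ω : Φ ⊗[k] H}
    (hω : ∀ h ∈ E, ω * 1 ⊗ₜ h ∈ LinearMap.range (N.subtype.rTensor H)) :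
    ω ∈ LinearMap.range (N.subtype.rTensor H) := by
  have hex : Function.Exact (N.subtype.rTensor H) (N.mkQ.rTensor H) :=
    rTensor_exact H (LinearMap.exact_subtype_mkQ N) N.mkQ_surjective
  rw [← LinearMap.exact_iff.mp hex, LinearMap.mem_ker]
  let b := Module.Free.chooseBasis k (Φ ⧸ N)
  have hc (ω : Φ ⊗[k] H) (i) (h : H) :
      TensorProduct.equivFinsuppOfBasisLeft b (N.mkQ.rTensor H (ω * 1 ⊗ₜ h)) i =
        TensorProduct.equivFinsuppOfBasisLeft b (N.mkQ.rTensor H ω) i * h := by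
    induction ω with
    | zero => simp
    | add t u ht hu => rw [add_mul, map_add, map_add, map_add, map_add, Finsupp.add_apply, ht, hu,
        Finsupp.add_apply, add_mul]
    | tmul y x => simp
  refine (TensorProduct.equivFinsuppOfBasisLeft b).injective ?_
  ext i
  rw [map_zero, Finsupp.zero_apply]
  refine hE _ fun h hh ↦ ?_
  have := hω h hh
  rw [← LinearMap.exact_iff.mp hex, LinearMap.mem_ker] at this
  rw [← hc, this, map_zero, Finsupp.zero_apply]

theorem rTensor_antipode_mul_tmul (κ : H →ₐ[k] Φ) (u : H ⊗[k] H) (a b : H) :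
    κ.toLinearMap.rTensor H ((antipode k).rTensor H (u * a ⊗ₜ b)) =
      κ (antipode k a) ⊗ₜ 1 * κ.toLinearMap.rTensor H ((antipode k).rTensor H u) * 1 ⊗ₜ b := by
  induction u with
  | zero => simp
  | add t u ht hu => simp only [add_mul, mul_add, map_add, ht, hu]
  | tmul x y => simp [antipode_mul_antidistrib]

theorem twist_antipode_mul_comul (κ : H →ₐ[k] Φ) (ω : Φ ⊗[k] H) (h : H) :
    twist κ ((antipode k).rTensor H ∘ₗ comul) (ω * κ.toLinearMap.rTensor H (comul h)) =
      twist κ ((antipode k).rTensor H ∘ₗ comul) ω * 1 ⊗ₜ h := by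
  induction ω with
  | zero => simp
  | add t u ht hu => simp only [add_mul, map_add, ht, hu]
  | tmul φ x =>
    obtain ⟨n, X, hX, a, rfl⟩ := exists_isComoduleMatrix (k := k) h
    simp only [map_sum, map_smul, Finset.mul_sum, TensorProduct.tmul_sum, TensorProduct.tmul_smul,
      mul_smul_comm]
    refine Finset.sum_congr rfl fun i _ ↦ Finset.sum_congr rfl fun j _ ↦ congrArg (a i j • ·) ?_
    have hXS (m) := congr(κ ($hX.mul_map_antipode i m))
    simp only [Matrix.mul_apply, Matrix.map_apply, map_sum, map_mul] at hXS
    have h₁ (l) : (φ * κ (X i l)) ⊗ₜ[k] (1 : H) *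
          κ.toLinearMap.rTensor H ((antipode k).rTensor H (comul (x * X l j))) =
        ∑ m, (φ * (κ (X i l) * κ (antipode k (X l m)))) ⊗ₜ[k] (1 : H) *
          κ.toLinearMap.rTensor H ((antipode k).rTensor H (comul x)) * 1 ⊗ₜ X m j := by
      rw [Bialgebra.comul_mul, hX.comul_apply, Finset.mul_sum, map_sum, map_sum, Finset.mul_sum]
      refine Finset.sum_congr rfl fun m _ ↦ ?_
      rw [rTensor_antipode_mul_tmul, ← mul_assoc, ← mul_assoc,
        Algebra.TensorProduct.tmul_mul_tmul, one_mul, mul_assoc φ]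
    simp only [hX.comul_apply, map_sum, LinearMap.rTensor_tmul, Finset.mul_sum,
      AlgHom.toLinearMap_apply, Algebra.TensorProduct.tmul_mul_tmul, twist_tmul,
      LinearMap.comp_apply, h₁]
    rw [Finset.sum_comm]
    simp only [← Finset.sum_mul, ← TensorProduct.sum_tmul, ← Finset.mul_sum, hXS]
    simp [Matrix.one_apply, apply_ite, ite_mul, TensorProduct.ite_tmul]

theorem twist_comul_twist_antipode (κ : H →ₐ[k] Φ) (ω : Φ ⊗[k] H) :
    twist κ comul (twist κ ((antipode k).rTensor H ∘ₗ comul) ω) = ω := by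
  induction ω with
  | zero => simp
  | add t u ht hu => simp only [map_add, ht, hu]
  | tmul φ x =>
    obtain ⟨n, X, hX, a, rfl⟩ := exists_isComoduleMatrix (k := k) x
    simp only [map_sum, map_smul, TensorProduct.tmul_sum, TensorProduct.tmul_smul]
    refine Finset.sum_congr rfl fun i _ ↦ Finset.sum_congr rfl fun j _ ↦ congrArg (a i j • ·) ?_
    have hXS (m) := congr(κ ($hX.map_antipode_mul i m))
    simp only [Matrix.mul_apply, Matrix.map_apply, map_sum, map_mul] at hXS
    simp only [twist_tmul, LinearMap.comp_apply, hX.comul_apply, map_sum, LinearMap.rTensor_tmul,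
      AlgHom.toLinearMap_apply, Finset.mul_sum, Algebra.TensorProduct.tmul_mul_tmul, one_mul,
      mul_assoc]
    rw [Finset.sum_comm]
    simp only [← Finset.mul_sum, ← TensorProduct.sum_tmul, hXS]
    simp [Matrix.one_apply, apply_ite, TensorProduct.ite_tmul]

end Twist

section Descent

open HopfAlgebra

variable {k H : Type*} [Field k] [Ring H] [HopfAlgebra k H] {n : ℕ}
  {X : Matrix (Fin n) (Fin n) H}

theorem IsComoduleMatrix.mem_range_of_mul_eq_smul_one {Φ : Type*} [Ring Φ] [Algebra k Φ]
    (hX : IsComoduleMatrix k X)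
    (hE : ∀ x : H, (∀ (h : H) (Z : Matrix (Fin n) (Fin n) H),
      X.transpose * Z = .diagonal (fun _ ↦ h) → x * h = 0) → x = 0)
    {d : H} (hd : d ≠ 0) {F : Matrix (Fin n) (Fin n) H} (hF : F * X.transpose = d • 1)
    (κ : H →ₐ[k] Φ) {δ : Φ} {z : Matrix (Fin n) (Fin n) Φ}
    (hz : z * X.transpose.map κ = δ • 1) (i j : Fin n) : ∃ t, z i j = δ * κ t := by
  let N : Submodule k Φ := LinearMap.range (LinearMap.mulLeft k δ ∘ₗ κ.toLinearMap)
  have hN : ∀ y ∈ N, ∀ a, y * κ a ∈ N := by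
    rintro _ ⟨b, rfl⟩ a
    exact ⟨b * a, by simp [mul_assoc]⟩
  let L := (Algebra.TensorProduct.includeLeft : Φ →ₐ[k] Φ ⊗[k] H).mapMatrix (m := Fin n)
  let R := (Algebra.TensorProduct.includeRight : H →ₐ[k] Φ ⊗[k] H).mapMatrix (m := Fin n)
  let D' : H →ₐ[k] Φ ⊗[k] H :=
    (Algebra.TensorProduct.map κ (AlgHom.id k H)).comp (Bialgebra.comulAlgHom k H)
  have hD' (h) : D' h = κ.toLinearMap.rTensor H (comul (R := k) h) := rfl
  let D := D'.mapMatrix (m := Fin n)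
  have hD : D X.transpose = R X.transpose * L (X.transpose.map κ) := by
    ext i j
    simp [D, L, R, Matrix.mul_apply, hD', hX.comul_apply]
  let Ξ := L z * R F
  have hLR (A : Matrix (Fin n) (Fin n) Φ) (c : H) :
      L A * R (c • 1) = R (c • 1) * L A := by
    ext i j
    simp [L, R, Matrix.mul_apply, Matrix.one_apply, apply_ite, ite_mul]
  have hΞ₁ : Ξ * R X.transpose = L z * R (d • 1) := by
    rw [mul_assoc, ← map_mul, hF]
  have hΞ₂ : Ξ * D X.transpose = (δ ⊗ₜ[k] d) • 1 := by
    rw [hD, ← mul_assoc, hΞ₁, mul_assoc, ← hLR, ← mul_assoc, ← map_mul, hz]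
    ext i j
    by_cases hij : i = j <;>
      simp [L, R, Matrix.mul_apply, Matrix.one_apply, apply_ite, ite_mul, hij]
  have hΞ (i j) : Ξ i j ∈ LinearMap.range (N.subtype.rTensor H) := by
    rw [← twist_comul_twist_antipode κ (Ξ i j)]
    refine twist_mem_range hN _ (mem_range_rTensor_of_mul_mem
      (E := {h | ∃ Z : Matrix (Fin n) (Fin n) H, X.transpose * Z = .diagonal (fun _ ↦ h)})
      (fun x hx ↦ hE x fun h Z hZ ↦ hx h ⟨Z, hZ⟩) ?_)
    rintro h ⟨Z, hZ⟩
    rw [← twist_antipode_mul_comul]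
    refine twist_mem_range hN _ ?_
    have hmul : Ξ * D (.diagonal fun _ ↦ h) = (δ ⊗ₜ[k] d) • D Z := by
      rw [← hZ, map_mul, ← mul_assoc, hΞ₂, Matrix.smul_mul, one_mul]
    have hij := congr($hmul i j)
    simp only [D, AlgHom.mapMatrix_apply, Matrix.diagonal_map (map_zero D'),
      Matrix.mul_diagonal, Matrix.smul_apply, Matrix.map_apply, hD', smul_eq_mul] at hij
    rw [hij]
    exact mul_rTensor_mem_range hN ⟨⟨δ, 1, by simp⟩ ⊗ₜ d, by simp⟩ _
  have hzd : z i j ⊗ₜ[k] d ∈ LinearMap.range (N.subtype.rTensor H) := by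
    have h := congr($hΞ₁ i j)
    have h' : (L z * R (d • 1)) i j = z i j ⊗ₜ[k] d := by
      simp [L, R, Matrix.mul_apply, Matrix.one_apply, apply_ite]
    rw [← h', ← h, Matrix.mul_apply]
    refine Submodule.sum_mem _ fun l _ ↦ ?_
    obtain ⟨t, ht⟩ := hΞ i l
    refine ⟨(LinearMap.mulRight k (X.transpose l j)).lTensor N t, ?_⟩
    rw [← ht]
    clear ht
    induction t with
    | zero => simp
    | add t u ht hu => simp only [map_add, add_mul, ht, hu]
    | tmul y x => simp [R]
  obtain ⟨φ, hφ⟩ := Module.Projective.exists_dual_ne_zero k hd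
  have hmem : φ d • z i j ∈ N := by
    obtain ⟨t, ht⟩ := hzd
    have h : TensorProduct.rid k Φ (φ.lTensor Φ (N.subtype.rTensor H t)) ∈ N := by
      clear ht
      induction t with
      | zero => simp
      | add t u ht hu => simp only [map_add]; exact add_mem ht hu
      | tmul y x => simpa using N.smul_mem _ y.2
    simpa [ht] using h
  obtain ⟨t, ht⟩ := (N.smul_mem_iff hφ).mp hmem
  exact ⟨t, ht.symm⟩

theorem IsComoduleMatrix.exists_mul_transpose_eq_one [IsNoetherianRing H] [IsNoetherianRing Hᵐᵒᵖ]
    (hH : IsSemiprimeRing H) (hX : IsComoduleMatrix k X) :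
    ∃ t : Matrix (Fin n) (Fin n) H, t * X.transpose = 1 := by
  have hS := antipode_injective_of_isNoetherianRing (k := k) (H := H)
  have hleft {x : H} := hH.eq_zero_of_mul_eq_smul_one (x := x)
    (fun _ h ↦ hX.eq_zero_of_mul_transpose_eq_zero hS h)
  by_cases hd : ∀ (d : H) (F : Matrix (Fin n) (Fin n) H), F * X.transpose = d • 1 → d = 0
  · have : Subsingleton H := subsingleton_of_zero_eq_one
      (hleft (x := 1) fun d F hF ↦ by rw [hd d F hF, zero_mul]).symm
    exact ⟨0, Subsingleton.elim _ _⟩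
  push Not at hd
  obtain ⟨d, F, hF, hd⟩ := hd
  let I := {p : H × Matrix (Fin n) (Fin n) H // p.2 * X.transpose = p.1 • 1}
  have h := hX.mem_range_of_mul_eq_smul_one
    (fun x hx ↦ hX.eq_zero_of_mul_scalar_eq_zero hH hS hx) hd hF (Pi.constAlgHom k I H)
    (δ := fun p ↦ p.1.1) (z := .of fun i j p ↦ p.1.2 i j) (by
      ext i j p
      simpa [Matrix.mul_apply, Matrix.one_apply, ite_apply] using congr($(p.2) i j))
  choose t ht using h
  refine ⟨.of t, ?_⟩
  ext i j
  refine sub_eq_zero.mp (hleft fun d F hF ↦ ?_)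
  have hFt : F = d • Matrix.of t := by
    ext i j
    exact congrFun (ht i j) ⟨(d, F), hF⟩
  rw [hFt, Matrix.smul_mul] at hF
  have := congr($hF i j)
  simpa [mul_sub, sub_eq_zero] using this

end Descent

section Multilinearization

open MonoidAlgebra

variable {k A : Type*} [Field k] [Ring A] [Algebra k A]

/-- Evaluation of a noncommutative polynomial. -/
noncomputable def wordEval {ι : Type*} (y : ι → A) : MonoidAlgebra k (FreeMonoid ι) →ₐ[k] A :=
  MonoidAlgebra.lift k A (FreeMonoid ι) (FreeMonoid.lift y)

theorem wordEval_apply {ι : Type*} (y : ι → A) (g : MonoidAlgebra k (FreeMonoid ι)) :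
    wordEval y g = g.coeff.sum fun w c ↦ c • (w.toList.map y).prod := by
  simp [wordEval, MonoidAlgebra.lift_apply, FreeMonoid.lift_apply]

/-- The noncommutative variables splitting the variables `i j` into sums of variables. -/
noncomputable def splitVar (k : Type*) [Field k] {n r : ℕ} (i : Fin r → Fin n) (c : Fin n) :
    MonoidAlgebra k (FreeMonoid (Fin r)) :=
  ∑ j, if i j = c then single (.of j) 1 else 0

open Classical in
theorem coeff_lift_splitVar {n r : ℕ} (i : Fin r → Fin n) (u : FreeMonoid (Fin n))
    (w : FreeMonoid (Fin r)) :
    (FreeMonoid.lift (splitVar k i) u).coeff w =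
      if FreeMonoid.map i w = u then 1 else 0 := by
  classical
  induction u using FreeMonoid.inductionOn' generalizing w with
  | one =>
    rw [map_one, MonoidAlgebra.one_def, MonoidAlgebra.coeff_single, Finsupp.single_apply]
    congr 1
    rw [eq_comm, eq_iff_iff]
    exact ⟨fun h ↦ (List.map_eq_nil_iff.mp h).symm, fun h ↦ h ▸ rfl⟩
  | of_mul c u ih =>
    rw [map_mul, FreeMonoid.lift_eval_of, splitVar, Finset.sum_mul, MonoidAlgebra.coeff_sum,
      Finsupp.finsetSum_apply]
    induction w using FreeMonoid.casesOn with
    | one =>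
      rw [if_neg (by simpa using fun h ↦ List.cons_ne_nil c u h.symm)]
      refine Finset.sum_eq_zero fun j _ ↦ ?_
      split_ifs
      · exact coeff_single_mul_of_forall_mul_ne _ _ fun d h ↦ List.cons_ne_nil j d h
      · simp
    | of_mul x w =>
      rw [Finset.sum_eq_single x]
      · split_ifs with h₁ h₂ h₂
        · rw [coeff_single_mul_eq_mul_coeff w (by simp), ih, one_mul, if_pos]
          simpa [h₁] using h₂
        · rw [coeff_single_mul_eq_mul_coeff w (by simp), ih, one_mul, if_neg]
          simpa [h₁] using h₂
        · exact absurd (List.cons.inj h₂).1 h₁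
        · simp
      · intro j _ hj
        split_ifs
        · exact coeff_single_mul_of_forall_mul_ne _ _ fun d h ↦ hj (List.cons.inj h).1
        · simp
      · simp

theorem coeff_wordEval_splitVar {n r : ℕ} (i : Fin r → Fin n)
    (g : MonoidAlgebra k (FreeMonoid (Fin n))) (w : FreeMonoid (Fin r)) :
    (wordEval (splitVar k i) g).coeff w = g.coeff (FreeMonoid.map i w) := by
  classical
  simp only [wordEval, MonoidAlgebra.lift_apply, Finsupp.sum, MonoidAlgebra.coeff_sum,
    Finsupp.finsetSum_apply, MonoidAlgebra.coeff_smul, Finsupp.smul_apply, coeff_lift_splitVar]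
  simp [eq_comm]

open Classical in
theorem wordEval_filter_mem_eq_zero {ι : Type*} {g : MonoidAlgebra k (FreeMonoid ι)}
    (hg : ∀ y : ι → A, wordEval y g = 0) (j : ι) (y : ι → A) :
    wordEval y (ofCoeff (g.coeff.filter fun w ↦ j ∈ w.toList)) = 0 := by
  classical
  have hadd (y : ι → A) := hg y
  rw [← ofCoeff_coeff g, ← Finsupp.filter_add_filter_not g.coeff (fun w ↦ j ∈ w.toList)]
    at hadd
  simp only [ofCoeff_add, map_add] at hadd
  have hpos : wordEval (Function.update y j 0)
      (ofCoeff (g.coeff.filter fun w ↦ j ∈ w.toList)) = 0 := by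
    rw [wordEval_apply]
    refine Finset.sum_eq_zero fun w hw ↦ ?_
    rw [coeff_ofCoeff, Finsupp.support_filter, Finset.mem_filter] at hw
    refine (congrArg _ (List.prod_eq_zero ?_)).trans (smul_zero _)
    exact List.mem_map.mpr ⟨j, hw.2, by simp⟩
  have hneg : wordEval (Function.update y j 0)
      (ofCoeff (g.coeff.filter fun w ↦ ¬ j ∈ w.toList)) =
        wordEval y (ofCoeff (g.coeff.filter fun w ↦ ¬ j ∈ w.toList)) := by
    rw [wordEval_apply, wordEval_apply]
    refine Finset.sum_congr rfl fun w hw ↦ ?_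
    rw [coeff_ofCoeff, Finsupp.support_filter, Finset.mem_filter] at hw
    refine congrArg (_ • List.prod ·) (List.map_congr_left fun l hl ↦ Function.update_of_ne ?_ _ _)
    rintro rfl
    exact hw.2 hl
  have h := hadd (Function.update y j 0)
  rw [hpos, hneg, zero_add] at h
  simpa [h] using hadd y

open Classical in
theorem wordEval_filter_eq_zero {ι : Type*} {g : MonoidAlgebra k (FreeMonoid ι)}
    (hg : ∀ y : ι → A, wordEval y g = 0) (s : Finset ι) (y : ι → A) :
    wordEval y (ofCoeff (g.coeff.filter fun w ↦ ∀ j ∈ s, j ∈ w.toList)) = 0 := by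
  classical
  induction s using Finset.induction_on generalizing y with
  | empty =>
    have h : (g.coeff.filter fun w ↦ ∀ j ∈ (∅ : Finset ι), j ∈ w.toList) = g.coeff := by
      ext; simp
    rw [h, ofCoeff_coeff, hg]
  | insert a s _ ih =>
    have h := wordEval_filter_mem_eq_zero ih a y
    rw [coeff_ofCoeff] at h
    rw [← h]
    congr 2
    ext w
    simp only [Finsupp.filter_apply, Finset.forall_mem_insert]
    split_ifs <;> tauto

theorem List.exists_perm_ofFn_eq {r : ℕ} (l : List (Fin r)) (hlen : l.length ≤ r)
    (hl : ∀ j, j ∈ l) : ∃ σ : Equiv.Perm (Fin r), List.ofFn σ = l := by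
  have hr : l.length = r := by
    refine hlen.antisymm ?_
    have h : l.toFinset = Finset.univ := by ext; simp [hl]
    simpa [h] using l.toFinset_card_le
  let f (j : Fin r) : Fin r := l.get (j.cast hr.symm)
  have hf : Function.Surjective f := fun j ↦ by
    obtain ⟨m, hm⟩ := List.get_of_mem (hl j)
    exact ⟨m.cast hr, hm⟩
  refine ⟨Equiv.ofBijective f (Finite.surjective_iff_bijective.mp hf), ?_⟩
  refine List.ext_getElem (by simp [hr]) fun m _ _ ↦ by simp [f]

theorem wordEval_filter_forall_eq_zero {ι : Type*} [Fintype ι]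
    {g : MonoidAlgebra k (FreeMonoid ι)} (hg : ∀ y : ι → A, wordEval y g = 0)
    (p : FreeMonoid ι → Prop) [DecidablePred p] (hp : ∀ w, p w ↔ ∀ j, j ∈ w.toList) (y : ι → A) :
    wordEval y (ofCoeff (g.coeff.filter p)) = 0 := by
  classical
  rw [← wordEval_filter_eq_zero hg Finset.univ y]
  congr 2
  ext w
  simp [Finsupp.filter_apply, hp]

/-- A nontrivial polynomial identity implies a nontrivial multilinear one. -/
theorem SatisfiesPolynomialIdentity.exists_multilinear {k A : Type u} [Field k] [Ring A]
    [Algebra k A] (h : SatisfiesPolynomialIdentity k A) :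
    ∃ (r : ℕ) (a : Equiv.Perm (Fin r) → k), a 1 ≠ 0 ∧
      ∀ y : Fin r → A, ∑ σ, a σ • (List.ofFn (y ∘ σ)).prod = 0 := by
  classical
  obtain ⟨n, f, hf, hfA⟩ := h
  let g := FreeAlgebra.equivMonoidAlgebraFreeMonoid f
  have hg : g ≠ 0 := by simpa [g] using hf
  have hgA (x : Fin n → A) : wordEval x g = 0 := by
    have h : (wordEval (k := k) x).comp
        FreeAlgebra.equivMonoidAlgebraFreeMonoid.toAlgHom = FreeAlgebra.lift k x := by
      ext c
      simp [wordEval, FreeAlgebra.equivMonoidAlgebraFreeMonoid]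
    rw [← hfA x, ← h]
    rfl
  have hsupp : g.coeff.support.Nonempty := by simpa using hg
  obtain ⟨w, hw, hmax⟩ := g.coeff.support.exists_max_image (fun w ↦ w.toList.length) hsupp
  let i : Fin w.toList.length → Fin n := w.toList.get
  let g' := wordEval (splitVar k i) g
  have hg'A (y : Fin w.toList.length → A) : wordEval y g' = 0 := by
    rw [← hgA fun c ↦ wordEval (k := k) y (splitVar k i c)]
    have h : (wordEval (k := k) y).comp (wordEval (splitVar k i)) =
        wordEval fun c ↦ wordEval (k := k) y (splitVar k i c) := by
      refine MonoidAlgebra.algHom_ext' ?_ (by ext)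
      ext c
      simp [wordEval]
    rw [← h]
    rfl
  refine ⟨w.toList.length, fun σ ↦ g'.coeff (.ofList (List.ofFn σ)), ?_, fun y ↦ ?_⟩
  · change (wordEval (splitVar k i) g).coeff _ ≠ 0
    rw [coeff_wordEval_splitVar]
    have : FreeMonoid.map i (.ofList (List.ofFn (1 : Equiv.Perm (Fin w.toList.length)))) = w := by
      refine FreeMonoid.toList.injective ?_
      rw [FreeMonoid.toList_map, FreeMonoid.toList_ofList, List.map_ofFn]
      exact List.ofFn_get w.toList
    rw [this]
    exact Finsupp.mem_support_iff.mp hw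
  · rw [← wordEval_filter_forall_eq_zero hg'A (fun v ↦ ∀ j, j ∈ v.toList) (fun _ ↦ Iff.rfl) y,
      wordEval_apply]
    let e (σ : Equiv.Perm (Fin w.toList.length)) : FreeMonoid (Fin w.toList.length) :=
      .ofList (List.ofFn σ)
    have he : Function.Injective e := fun σ τ h ↦
      DFunLike.coe_injective (List.ofFn_injective (FreeMonoid.ofList.injective h))
    have hall (σ) (j) : j ∈ (e σ).toList := by
      simpa [e] using ⟨σ.symm j, by simp⟩
    rw [Finsupp.sum_of_support_subset (s := Finset.univ.map ⟨e, he⟩), Finset.sum_map]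
    · refine Finset.sum_congr rfl fun σ _ ↦ ?_
      rw [coeff_ofCoeff, Finsupp.filter_apply_pos _ _ (hall σ)]
      simp [e, List.map_ofFn]
    · intro v hv
      rw [coeff_ofCoeff, Finsupp.mem_support_iff, Finsupp.filter_apply, ite_ne_right_iff] at hv
      have hlen : v.toList.length ≤ w.toList.length := by
        have := hmax (FreeMonoid.map i v) (by
          rw [Finsupp.mem_support_iff, ← coeff_wordEval_splitVar]
          exact hv.2)
        rwa [FreeMonoid.toList_map, List.length_map] at this
      obtain ⟨σ, hσ⟩ := v.toList.exists_perm_ofFn_eq hlen hv.1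
      exact Finset.mem_map.mpr ⟨σ, Finset.mem_univ _, FreeMonoid.toList.injective hσ⟩
    · simp

end Multilinearization

section MaximalSubfield

/-- A division algebra contains a field which is its own centralizer. -/
theorem exists_field_eq_centralizer (k : Type*) {D : Type*} [Field k] [Ring D] [Nontrivial D]
    [Algebra k D] (hD : ∀ d : D, d ≠ 0 → IsUnit d) :
    ∃ (L : Subalgebra k D), IsField L ∧ ∀ d : D, (∀ l ∈ L, d * l = l * d) → d ∈ L := by
  obtain ⟨s, hs⟩ := zorn_subset {s : Set D | ∀ x ∈ s, ∀ y ∈ s, x * y = y * x} fun c hc hchain ↦ by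
    refine ⟨⋃₀ c, ?_, fun s hs ↦ Set.subset_sUnion_of_mem hs⟩
    rintro x ⟨s, hs, hx⟩ y ⟨t, ht, hy⟩
    obtain h | h := hchain.total hs ht
    · exact hc ht x (h hx) y hy
    · exact hc hs x hx y (h hy)
  have hmem (d : D) (hd : ∀ x ∈ s, d * x = x * d) : d ∈ s := by
    refine hs.2 (y := insert d s) ?_ (Set.subset_insert d s) (Set.mem_insert d s)
    rintro x (rfl | hx) y (rfl | hy)
    · rfl
    · exact hd y hy
    · exact (hd x hx).symm
    · exact hs.1 x hx y hy
  have hcent (d : D) : d ∈ Subalgebra.centralizer k s ↔ d ∈ s := by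
    rw [Subalgebra.mem_centralizer_iff]
    exact ⟨fun h ↦ hmem d fun x hx ↦ (h x hx).symm, fun h x hx ↦ hs.1 x hx d h⟩
  refine ⟨Subalgebra.centralizer k s, ⟨⟨0, 1, zero_ne_one⟩, fun x y ↦ ?_, fun {x} hx ↦ ?_⟩,
    fun d hd ↦ (hcent d).mpr (hmem d fun x hx ↦ hd x ((hcent x).mpr hx))⟩
  · exact Subtype.ext (hs.1 x ((hcent x).mp x.2) y ((hcent y).mp y.2))
  · obtain ⟨u, hu⟩ := hD x fun h ↦ hx (Subtype.ext h)
    refine ⟨⟨↑u⁻¹, (hcent _).mpr (hmem _ fun y hy ↦ ?_)⟩, Subtype.ext ?_⟩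
    · have h : u * y = y * u := by
        rw [hu]
        exact hs.1 x ((hcent x).mp x.2) y hy
      rw [Units.inv_mul_eq_iff_eq_mul, ← mul_assoc, h, mul_assoc, Units.mul_inv, mul_one]
    · simp [← hu]

end MaximalSubfield

section MultilinearIdentity

variable {k H : Type*} [Field k] [Ring H] [Algebra k H]

/-- A multilinear identity is preserved by extension of scalars. -/
theorem sum_smul_prod_eq_zero_of_tensorProduct {r : ℕ} {a : Equiv.Perm (Fin r) → k}
    (ha : ∀ y : Fin r → H, ∑ σ, a σ • (List.ofFn (y ∘ σ)).prod = 0) (L : Type*) [Field L]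
    [Algebra k L] (y : Fin r → L ⊗[k] H) : ∑ σ, a σ • (List.ofFn (y ∘ σ)).prod = 0 := by
  let P : MultilinearMap L (fun _ : Fin r ↦ L ⊗[k] H) (L ⊗[k] H) :=
    ∑ σ, algebraMap k L (a σ) • (MultilinearMap.mkPiAlgebraFin L r (L ⊗[k] H)).domDomCongr σ
  have hP (y : Fin r → L ⊗[k] H) : P y = ∑ σ, a σ • (List.ofFn (y ∘ σ)).prod := by
    simp [P, Function.comp_def]
  have h : P = 0 := by
    refine Module.Basis.ext_multilinear
      (fun _ ↦ Algebra.TensorProduct.basis L (Module.Free.chooseBasis k H)) fun v ↦ ?_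
    rw [hP]
    let f : H →ₐ[k] L ⊗[k] H := Algebra.TensorProduct.includeRight
    have hf (σ : Equiv.Perm (Fin r)) :
        (List.ofFn ((fun i ↦ Algebra.TensorProduct.basis L (Module.Free.chooseBasis k H) (v i)) ∘
          σ)).prod = f (List.ofFn ((fun i ↦ Module.Free.chooseBasis k H (v i)) ∘ σ)).prod := by
      rw [map_list_prod, List.map_ofFn]
      congr 2
      ext i
      simp [f]
    simp only [hf, ← map_smul, ← map_sum, ha, map_zero, zero_apply]
  rw [← hP, h, zero_apply]

/-- Matrix units along a chain of linearly independent vectors violate any multilinear identity. -/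
theorem eq_zero_of_sum_smul_prod_eq_zero {R V : Type*} [Ring R] [Algebra k R] [AddCommGroup V]
    [Module R V] [Module k V] [IsScalarTower k R V] {r : ℕ} {a : Equiv.Perm (Fin r) → k}
    (ha : ∀ y : Fin r → R, ∑ σ, a σ • (List.ofFn (y ∘ σ)).prod = 0) (e : ℕ → V)
    (he : e 0 ≠ 0) (x : ℕ → R)
    (hx : ∀ i < r, ∀ j ≤ r, x i • e j = if j = i + 1 then e i else 0) : a 1 = 0 := by
  have h₁ (l : List ℕ) (hl : ∀ i ∈ l, i < r) (m : ℕ) (hm : m ≤ r) :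
      (l.map x).prod • e m = 0 ∨ ∃ j, j + l.length = m ∧ l = List.range' j l.length ∧
        (l.map x).prod • e m = e j := by
    induction l with
    | nil => exact .inr ⟨m, by simp⟩
    | cons c l ih =>
      rw [List.map_cons, List.prod_cons, mul_smul]
      obtain h | ⟨j, hj, hl', h⟩ := ih fun i hi ↦ hl i (List.mem_cons_of_mem c hi)
      · rw [h, smul_zero]
        exact .inl rfl
      · rw [h, hx c (hl c List.mem_cons_self) j (by omega)]
        split_ifs with hc
        · refine .inr ⟨c, by rw [List.length_cons]; omega, ?_, rfl⟩
          rw [List.length_cons, List.range'_succ, ← hc, ← hl']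
        · exact .inl rfl
  have h₂ (m j : ℕ) (hm : j + m ≤ r) : ((List.range' j m).map x).prod • e (j + m) = e j := by
    induction m generalizing j with
    | zero => simp
    | succ m ih =>
      rw [List.range'_succ, List.map_cons, List.prod_cons, mul_smul, ← add_assoc,
        add_right_comm, ih (j + 1) (by omega), hx j (by omega) _ (by omega), if_pos rfl]
  have h := congr($(ha fun i ↦ x i) • e r)
  have hofFn (σ : Equiv.Perm (Fin r)) : List.ofFn ((fun i : Fin r ↦ x i) ∘ σ) =
      (List.ofFn fun i ↦ (σ i : ℕ)).map x := by
    rw [List.map_ofFn]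
    rfl
  rw [Finset.sum_smul, Finset.sum_eq_single 1, zero_smul, hofFn, smul_assoc] at h
  · have hr : (List.ofFn fun i ↦ ((1 : Equiv.Perm (Fin r)) i : ℕ)) = List.range' 0 r := by
      refine List.ext_getElem (by simp) fun _ _ _ ↦ by simp
    have h₂' := h₂ r 0 (by simp)
    rw [zero_add] at h₂'
    rw [hr, h₂'] at h
    exact (smul_eq_zero.mp h).resolve_right he
  · intro σ _ hσ
    rw [hofFn, smul_assoc]
    obtain h | ⟨j, hj, hl, -⟩ := h₁ (List.ofFn fun i ↦ (σ i : ℕ)) (by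
      intro i hi
      obtain ⟨j, rfl⟩ := List.mem_ofFn.mp hi
      exact (σ j).2) r le_rfl
    · rw [h, smul_zero]
    · refine absurd (Equiv.ext fun i ↦ Fin.ext ?_) hσ
      have hj0 : j = 0 := by simpa using hj
      have := congr($hl[(i : ℕ)]?)
      simpa [hj0] using this
  · simp

end MultilinearIdentity

section Kaplansky

section

variable {k H V L : Type*} [Field k] [Ring H] [Algebra k H] [AddCommGroup V] [Module H V]
  [Module k V] [IsScalarTower k H V] [IsSimpleModule H V] [Field L] [Algebra k L] [Module L V]
  [SMulCommClass L H V] [IsScalarTower k L V]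

/-- Density theorem for a simple module whose only endomorphisms commuting with the field `L`
are the elements of `L`. -/
theorem exists_tensorProduct_smul_eq
    (hL : ∀ d : V →ₗ[H] V, (∀ (l : L) v, d (l • v) = l • d v) → ∃ l : L, ∀ v, d v = l • v)
    (g : V →ₗ[L] V) (s : Finset V) :
    letI : Module (L ⊗[k] H) V := TensorProduct.Algebra.module
    ∃ r : L ⊗[k] H, ∀ v ∈ s, g v = r • v := by
  let : Module (L ⊗[k] H) V := TensorProduct.Algebra.module
  have hsmul (l : L) (h : H) (v : V) : (l ⊗ₜ[k] h) • v = l • h • v :=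
    TensorProduct.Algebra.smul_def l h v
  have hsimple : IsSimpleModule (L ⊗[k] H) V := by
    have hH := isSimpleModule_iff_toSpanSingleton_surjective.mp ‹IsSimpleModule H V›
    refine isSimpleModule_iff_toSpanSingleton_surjective.mpr ⟨hH.1, fun m hm v ↦ ?_⟩
    obtain ⟨h, rfl⟩ := hH.2 m hm v
    exact ⟨1 ⊗ₜ h, by simp [hsmul]⟩
  have hend (d : Module.End (L ⊗[k] H) V) : ∃ l : L, ∀ v, d v = l • v := by
    have h₁ (l : L) (v : V) : d (l • v) = l • d v := by
      simpa [hsmul] using d.map_smul (l ⊗ₜ 1) v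
    have h₂ (h : H) (v : V) : d (h • v) = h • d v := by
      simpa [hsmul] using d.map_smul (1 ⊗ₜ h) v
    exact hL { toFun := d, map_add' := d.map_add, map_smul' := h₂ } h₁
  let g' : Module.End (Module.End (L ⊗[k] H) V) V :=
    { toFun := g
      map_add' := g.map_add
      map_smul' d v := by
        obtain ⟨l, hl⟩ := hend d
        change g (d v) = d (g v)
        rw [hl, hl, map_smul] }
  exact jacobson_density g' s

theorem finite_of_sum_smul_prod_eq_zero
    (hL : ∀ d : V →ₗ[H] V, (∀ (l : L) v, d (l • v) = l • d v) → ∃ l : L, ∀ v, d v = l • v)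
    {r : ℕ} {a : Equiv.Perm (Fin r) → k} (ha₁ : a 1 ≠ 0)
    (ha : ∀ y : Fin r → H, ∑ σ, a σ • (List.ofFn (y ∘ σ)).prod = 0) : Module.Finite L V := by
  classical
  by_contra hfin
  let b := Module.Free.chooseBasis L V
  have hinf : Infinite (Module.Free.ChooseBasisIndex L V) := by
    by_contra h
    have := not_infinite_iff_finite.mp h
    exact hfin (Module.Finite.of_basis b)
  let ν := Infinite.natEmbedding (Module.Free.ChooseBasisIndex L V)
  let e (i : ℕ) : V := b (ν i)
  let : Module (L ⊗[k] H) V := TensorProduct.Algebra.module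
  have : IsScalarTower k (L ⊗[k] H) V := ⟨fun c t v ↦ by
    induction t with
    | zero => simp
    | add t u ht hu => rw [smul_add, add_smul, ht, hu, add_smul, smul_add]
    | tmul l h =>
      rw [TensorProduct.smul_tmul']
      exact (TensorProduct.Algebra.smul_def _ _ _).trans (by
        rw [smul_assoc]
        exact congrArg (c • ·) (TensorProduct.Algebra.smul_def _ _ _).symm)⟩
  have hx (i : ℕ) : ∃ x : L ⊗[k] H, ∀ j ≤ r, x • e j = if j = i + 1 then e i else 0 := by
    obtain ⟨x, hx⟩ := exists_tensorProduct_smul_eq (k := k) hL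
      (b.constr L fun m ↦ if m = ν (i + 1) then e i else 0) ((Finset.range (r + 1)).image e)
    refine ⟨x, fun j hj ↦ ?_⟩
    rw [← hx _ (Finset.mem_image_of_mem e (Finset.mem_range_succ_iff.mpr hj)), b.constr_basis]
    simp [ν.injective.eq_iff]
  choose x hx using hx
  exact ha₁ (eq_zero_of_sum_smul_prod_eq_zero
    (sum_smul_prod_eq_zero_of_tensorProduct ha L) e (b.ne_zero _) x fun i _ j hj ↦ hx i j hj)

end

/-- A simple module over an algebra satisfying a polynomial identity embeds into a
finite-dimensional representation over an algebraically closed field. -/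
theorem SatisfiesPolynomialIdentity.exists_representation {k H V : Type u} [Field k] [Ring H]
    [Algebra k H] (hH : SatisfiesPolynomialIdentity k H) [AddCommGroup V] [Module H V] [Module k V]
    [IsScalarTower k H V] [IsSimpleModule H V] :
    ∃ (K : Type u) (_ : Field K) (_ : IsAlgClosed K) (_ : Algebra k K) (N : ℕ)
      (ρ : H →ₐ[k] Matrix (Fin N) (Fin N) K) (j : V →+ (Fin N → K)),
      Function.Injective j ∧ ∀ h v, j (h • v) = (ρ h).mulVec (j v) := by
  classical
  have : SMulCommClass H k V := IsScalarTower.to_smulCommClass'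
  have : Nontrivial V := IsSimpleModule.nontrivial H V
  obtain ⟨L, hL, hLmax⟩ := exists_field_eq_centralizer k (D := Module.End H V)
    fun d hd ↦ (Module.End.isUnit_iff d).mpr (LinearMap.bijective_of_ne_zero hd)
  let : Field L := { hL.toField with }
  have hLV (l : L) (v : V) : l • v = (l : Module.End H V) v := rfl
  have : SMulCommClass L H V := ⟨fun l h v ↦ by rw [hLV, hLV, map_smul]⟩
  have : IsScalarTower k L V := ⟨fun c l v ↦ rfl⟩
  obtain ⟨r, a, ha₁, ha⟩ := hH.exists_multilinear
  have : Module.Finite L V := by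
    refine finite_of_sum_smul_prod_eq_zero (H := H) (fun d hd ↦ ?_) ha₁ ha
    exact ⟨⟨d, hLmax d fun l hl ↦ LinearMap.ext fun v ↦ hd ⟨l, hl⟩ v⟩, fun v ↦ rfl⟩
  let b := Module.finBasis L V
  have : SMulCommClass L k V := inferInstance
  let ρ₁ : H →ₐ[k] Module.End L V :=
    { toFun h := { toFun v := h • v, map_add' := smul_add h, map_smul' l v := smul_comm h l v }
      map_one' := by ext; simp
      map_mul' g h := by ext v; exact mul_smul g h v
      map_zero' := by ext; simp
      map_add' g h := by ext v; exact add_smul g h v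
      commutes' c := by ext v; exact algebraMap_smul H c v }
  let K := AlgebraicClosure L
  refine ⟨K, inferInstance, inferInstance, inferInstance, Module.finrank L V,
    ((IsScalarTower.toAlgHom k L K).mapMatrix.comp
      ((LinearMap.toMatrixAlgEquiv b).restrictScalars k).toAlgHom).comp ρ₁,
    { toFun v i := algebraMap L K (b.repr v i)
      map_zero' := by ext; simp
      map_add' v w := by ext; simp }, fun v w h ↦ ?_, fun h v ↦ ?_⟩
  · refine b.repr.injective (Finsupp.ext fun i ↦ ?_)
    exact (algebraMap L K).injective (congrFun h i)
  · ext i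
    change algebraMap L K (b.repr (ρ₁ h v) i) = ∑ m,
      algebraMap L K (LinearMap.toMatrix b b (ρ₁ h) i m) * algebraMap L K (b.repr v m)
    rw [← LinearMap.toMatrix_mulVec_repr b b]
    simp [Matrix.mulVec, dotProduct]

end Kaplansky

section Representations

open HopfAlgebra

variable {k H K : Type*} [Field k] [Ring H] [HopfAlgebra k H] [Field K] [Algebra k K] {N : ℕ}

/-- The dual of a matrix representation of a Hopf algebra. -/
noncomputable def dualRepresentation (φ : H →ₐ[k] Matrix (Fin N) (Fin N) K) :
    H →ₐ[k] Matrix (Fin N) (Fin N) K :=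
  AlgHom.ofLinearMap
    ((Matrix.transposeLinearEquiv (Fin N) (Fin N) k K).toLinearMap ∘ₗ φ.toLinearMap ∘ₗ antipode k)
    (by simp [antipode_one]) (by simp [antipode_mul_antidistrib])

theorem dualRepresentation_apply (φ : H →ₐ[k] Matrix (Fin N) (Fin N) K) (h : H) :
    dualRepresentation φ h = (φ (antipode k h)).transpose := rfl

theorem dualRepresentation_injective :
    Function.Injective (dualRepresentation : (H →ₐ[k] Matrix (Fin N) (Fin N) K) → _) := by
  intro φ ψ h
  have hS (x : H) : φ (antipode k x) = ψ (antipode k x) :=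
    Matrix.transpose_injective congr($h x)
  ext1 x
  obtain ⟨n, X, hX, a, rfl⟩ := exists_isComoduleMatrix (k := k) x
  have h₁ := congr(φ.mapMatrix $(hX.mul_map_antipode))
  have h₂ := congr(ψ.mapMatrix $(hX.map_antipode_mul))
  rw [map_mul, map_one] at h₁ h₂
  have hX' : φ.mapMatrix (X.map (antipode k)) = ψ.mapMatrix (X.map (antipode k)) := by
    ext1 i j
    exact hS (X i j)
  have hφψ := left_inv_eq_right_inv (hX' ▸ h₁) h₂
  simp_rw [map_sum, map_smul]
  exact Finset.sum_congr rfl fun i _ ↦ Finset.sum_congr rfl fun j _ ↦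
    congr(a i j • $hφψ i j)

/-- Every matrix representation of a finitely generated Hopf algebra over an algebraically closed
field is a dual, by the Ax-Grothendieck theorem. -/
theorem dualRepresentation_surjective [Algebra.FiniteType k H] [IsAlgClosed K] :
    Function.Surjective (dualRepresentation : (H →ₐ[k] Matrix (Fin N) (Fin N) K) → _) := by
  classical
  obtain ⟨s, f, hf⟩ := Algebra.FiniteType.iff_quotient_freeAlgebra.mp ‹Algebra.FiniteType k H›
  let G : FreeAlgebra k s →ₐ[k] Matrix (Fin N) (Fin N) (MvPolynomial (s × Fin N × Fin N) K) :=
    FreeAlgebra.lift k fun x ↦ Matrix.of fun i j ↦ MvPolynomial.X (x, i, j)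
  let P (v : s × Fin N × Fin N → K) : FreeAlgebra k s →ₐ[k] Matrix (Fin N) (Fin N) K :=
    FreeAlgebra.lift k fun x ↦ Matrix.of fun i j ↦ v (x, i, j)
  have hPι v x i j : P v (FreeAlgebra.ι k x) i j = v (x, i, j) := by simp [P]
  have hPG v (a : FreeAlgebra k s) (i j : Fin N) :
      MvPolynomial.eval v (G a i j) = P v a i j := by
    have h : (((MvPolynomial.aeval v).restrictScalars k).mapMatrix).comp G = P v := by
      ext x i j
      simp [G, P]
    exact congr($h a i j)
  let I : Ideal (MvPolynomial (s × Fin N × Fin N) K) :=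
    Ideal.span {p | ∃ a i j, f a = 0 ∧ p = G a i j}
  have hI v : v ∈ MvPolynomial.zeroLocus K I ↔ ∃ φ : H →ₐ[k] _, φ.comp f = P v := by
    rw [MvPolynomial.zeroLocus_span]
    constructor
    · intro hv
      have hker (a) (ha : f a = 0) : P v a = 0 := by
        ext i j
        rw [← hPG]
        exact hv _ ⟨a, i, j, ha, rfl⟩
      have hwd (a b) (hab : f a = f b) : P v a = P v b := by
        rw [← sub_eq_zero, ← map_sub]
        exact hker _ (by rw [map_sub, hab, sub_self])
      have hinv := Function.surjInv_eq hf
      refine ⟨AlgHom.ofLinearMap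
        { toFun x := P v (Function.surjInv hf x)
          map_add' x y := by rw [← map_add]; exact hwd _ _ (by simp [hinv])
          map_smul' c x := by
            rw [RingHom.id_apply, ← map_smul]; exact hwd _ _ (by simp [hinv]) }
        ((hwd _ 1 (by simp [hinv])).trans (map_one _))
        fun x y ↦ (hwd _ _ (by simp [hinv])).trans (map_mul (P v) _ _), ?_⟩
      ext1
      funext x
      exact hwd _ _ (hinv _)
    · rintro ⟨φ, hφ⟩ _ ⟨a, i, j, ha, rfl⟩
      have h : P v a = 0 := by rw [← hφ, AlgHom.comp_apply, ha, map_zero]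
      exact (hPG v a i j).trans (by rw [h, Matrix.zero_apply])
  choose σ hσ using fun x : s ↦ hf (antipode k (f (FreeAlgebra.ι k x)))
  let p (y : s × Fin N × Fin N) : MvPolynomial (s × Fin N × Fin N) K := G (σ y.1) y.2.2 y.2.1
  have hp v (φ : H →ₐ[k] _) (hφ : φ.comp f = P v) :
      (dualRepresentation φ).comp f = P fun y ↦ MvPolynomial.eval v (p y) := by
    ext x i j
    simp only [Function.comp_apply, AlgHom.comp_apply, hPι, p, hPG]
    rw [dualRepresentation_apply, ← hσ, Matrix.transpose_apply, ← hφ, AlgHom.comp_apply]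
  have hP : Function.Injective P := fun v w h ↦ funext fun y ↦ by
    rw [← hPι v y.1, h, hPι]
  intro ρ
  let v (y : s × Fin N × Fin N) : K := ρ (f (FreeAlgebra.ι k y.1)) y.2.1 y.2.2
  have hv : ρ.comp f = P v := by
    ext x i j
    simp [hPι, v]
  have hcancel {φ ψ : H →ₐ[k] Matrix (Fin N) (Fin N) K} (h : φ.comp f = ψ.comp f) : φ = ψ :=
    (AlgHom.cancel_right hf).mp h
  obtain ⟨w, hw, hwv⟩ := ax_grothendieck_zeroLocus I p
    (fun w hw ↦ by
      obtain ⟨φ, hφ⟩ := (hI w).mp hw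
      exact (hI _).mpr ⟨_, hp w φ hφ⟩)
    (fun w hw w' hw' h ↦ by
      obtain ⟨φ, hφ⟩ := (hI w).mp hw
      obtain ⟨φ', hφ'⟩ := (hI w').mp hw'
      have := dualRepresentation_injective
        (hcancel ((hp w φ hφ).trans ((congrArg P h).trans (hp w' φ' hφ').symm)))
      exact hP (by rw [← hφ, ← hφ', this]))
    ((hI v).mpr ⟨ρ, hv⟩)
  obtain ⟨φ, hφ⟩ := (hI w).mp hw
  exact ⟨φ, hcancel ((hp w φ hφ).trans ((congrArg P hwv).trans hv.symm))⟩

end Representations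

section PolynomialIdentity

open HopfAlgebra

theorem IsComoduleMatrix.eq_zero_of_sum_map_mulVec_eq_zero {k H K : Type*} [Field k] [Ring H]
    [HopfAlgebra k H] [Field K] [Algebra k K] {n N : ℕ} {X : Matrix (Fin n) (Fin n) H}
    (hX : IsComoduleMatrix k X) (φ : H →ₐ[k] Matrix (Fin N) (Fin N) K) {v : Fin n → Fin N → K}
    (hv : ∀ i, ∑ j, (dualRepresentation φ (X j i)).mulVec (v j) = 0) : v = 0 := by
  funext j
  have h (l : Fin n) : ∑ i, (φ (X i j)).transpose * dualRepresentation φ (X l i) =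
      (1 : Matrix (Fin n) (Fin n) (Matrix (Fin N) (Fin N) K)) l j := by
    have h := congr((φ ($(hX.map_antipode_mul) l j)).transpose)
    rw [Matrix.mul_apply, map_sum, Matrix.transpose_sum] at h
    simp only [map_mul, Matrix.transpose_mul] at h
    refine h.trans ?_
    by_cases hlj : l = j <;> simp [Matrix.one_apply, hlj]
  calc v j = ∑ l, ((1 : Matrix (Fin n) (Fin n) (Matrix (Fin N) (Fin N) K)) l j).mulVec (v l) := by
        rw [Finset.sum_eq_single j (fun l _ hl ↦ by simp [Matrix.one_apply_ne hl]) (by simp),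
          Matrix.one_apply_eq, Matrix.one_mulVec]
    _ = ∑ i, (φ (X i j)).transpose.mulVec
          (∑ l, (dualRepresentation φ (X l i)).mulVec (v l)) := by
        simp_rw [← h, Matrix.sum_mulVec, Matrix.mulVec_sum, Matrix.mulVec_mulVec]
        exact Finset.sum_comm
    _ = 0 := by simp [hv]

theorem IsComoduleMatrix.exists_mul_transpose_eq_one_of_polynomialIdentity {k H : Type u}
    [Field k] [Ring H] [HopfAlgebra k H] [Algebra.FiniteType k H]
    (hH : SatisfiesPolynomialIdentity k H) {n : ℕ} {X : Matrix (Fin n) (Fin n) H}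
    (hX : IsComoduleMatrix k X) :
    ∃ t : Matrix (Fin n) (Fin n) H, t * X.transpose = 1 := by
  suffices h : LinearMap.range X.transpose.vecMulLinear = ⊤ by
    choose t ht using fun i ↦ LinearMap.range_eq_top.mp h (Pi.single i 1)
    refine ⟨Matrix.of t, ?_⟩
    ext i j
    exact congr($(ht i) j).trans (by simp [Matrix.one_apply, Pi.single_apply, eq_comm])
  by_contra hne
  obtain ⟨M, hM, hle⟩ := (eq_top_or_exists_le_coatom _).resolve_left hne
  have : IsSimpleModule H ((Fin n → H) ⧸ M) := isSimpleModule_iff_isCoatom.mpr hM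
  obtain ⟨K, _, _, _, N, ρ, f, hf, hρ⟩ := hH.exists_representation (V := (Fin n → H) ⧸ M)
  obtain ⟨φ, rfl⟩ := dualRepresentation_surjective ρ
  have hv := hX.eq_zero_of_sum_map_mulVec_eq_zero φ (v := fun j ↦ f (M.mkQ (Pi.single j 1)))
    fun i ↦ by
      simp_rw [← hρ, ← map_smul, ← map_sum]
      have hmem : X.transpose i ∈ M := by
        refine hle ⟨Pi.single i 1, ?_⟩
        rw [Matrix.vecMulLinear_apply, Matrix.single_one_vecMul]
        rfl
      have hsum : ∑ j, X j i • (Pi.single j 1 : Fin n → H) = X.transpose i :=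
        (pi_eq_sum_univ' _).symm
      rw [hsum, Submodule.mkQ_apply, (Submodule.Quotient.mk_eq_zero M).mpr hmem, map_zero]
  refine hM.1 (eq_top_iff.mpr fun x _ ↦ ?_)
  rw [← Submodule.Quotient.mk_eq_zero, ← Submodule.mkQ_apply, pi_eq_sum_univ' x, map_sum]
  refine Finset.sum_eq_zero fun j _ ↦ ?_
  rw [map_smul, hf ((congrFun hv j).trans (map_zero f).symm), smul_zero]

end PolynomialIdentity

theorem antipode_bijective_of_noetherian
    (k : Type u) [Field k] (H : Type u) [Ring H] [HopfAlgebra k H]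
    (hnoeth : IsNoetherianRing H) (hnoeth' : IsNoetherianRing Hᵐᵒᵖ)
    (h : IsSemiprimeRing H ∨
      (Algebra.FiniteType k H ∧ SatisfiesPolynomialIdentity k H)) :
    Function.Bijective (HopfAlgebra.antipode k : H →ₗ[k] H) := by
  refine ⟨antipode_injective_of_isNoetherianRing,
    antipode_surjective_of_forall_isComoduleMatrix fun n X hX ↦ ?_⟩
  rcases h with h | ⟨_, h⟩
  · exact hX.exists_mul_transpose_eq_one h
  · exact hX.exists_mul_transpose_eq_one_of_polynomialIdentity h
end
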